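/- arXiv:2303.13084 — 2 statements merged into one kernel-verified Lean document; each statement's English description precedes it below -/
import Mathlib

section
/- For every dimension d ≥ 1 there exists a constant c_d, depending only on d, such that every full-dimensional nearly Gorenstein lattice polytope P ⊆ ℝ^d has at most c_d facets. -/
open Set Pointwise

/-- The set of lattice points of `ℝ^d`. -/
def latticePoints (d : ℕ) : Set (Fin d → ℝ) :=
  {x | ∀ i, ∃ z : ℤ, x i = (z : ℝ)}

/-- A lattice polytope: the convex hull of a finite set of lattice points. -/
def IsLatticePolytope {d : ℕ} (P : Set (Fin d → ℝ)) : Prop :=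
  ∃ V : Finset (Fin d → ℝ), (V : Set (Fin d → ℝ)) ⊆ latticePoints d ∧
    P = convexHull ℝ (V : Set (Fin d → ℝ))

/-- The natural pairing of an integral linear functional with a point of `ℝ^d`. -/
def pairing {d : ℕ} (n : Fin d → ℤ) (x : Fin d → ℝ) : ℝ :=
  ∑ i, (n i : ℝ) * x i

/-- `P = {x | n_F(x) ≥ -h_F}` is an irredundant presentation with primitive
integral inner normals, i.e. the facet presentation of `P`. -/
def IsFacetPresentation {d m : ℕ} (P : Set (Fin d → ℝ))
    (n : Fin m → Fin d → ℤ) (h : Fin m → ℤ) : Prop :=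
  P = {x | ∀ i, pairing (n i) x ≥ -(h i : ℝ)} ∧
  (∀ i, Finset.univ.gcd (n i) = 1) ∧
  (∀ i, ∃ x : Fin d → ℝ, pairing (n i) x < -(h i : ℝ) ∧
    ∀ j, j ≠ i → pairing (n j) x ≥ -(h j : ℝ))

/-- `a` is the codegree of `P`: the least `k ≥ 1` such that `int(kP)` contains
a lattice point. -/
def IsCodegree {d : ℕ} (P : Set (Fin d → ℝ)) (a : ℕ) : Prop :=
  1 ≤ a ∧ (interior ((a : ℝ) • P) ∩ latticePoints d).Nonempty ∧
    ∀ k : ℕ, 1 ≤ k → (interior ((k : ℝ) • P) ∩ latticePoints d).Nonempty → a ≤ k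

/-- The floor polytope `⌊R⌋ = conv(int(R) ∩ ℤ^d)`. -/
def floorPoly {d : ℕ} (R : Set (Fin d → ℝ)) : Set (Fin d → ℝ) :=
  convexHull ℝ (interior R ∩ latticePoints d)

/-- The remainder polytope `{P} = conv{x ∈ ℤ^d | n_F(x) ≥ (a-1)h_F - 1}`,
defined in terms of the facet presentation data and the codegree `a`. -/
def remPoly {d m : ℕ} (n : Fin m → Fin d → ℤ) (h : Fin m → ℤ) (a : ℕ) :
    Set (Fin d → ℝ) :=
  convexHull ℝ {x | x ∈ latticePoints d ∧
    ∀ i, pairing (n i) x ≥ ((a : ℝ) - 1) * (h i : ℝ) - 1}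

/-- The cone `C_P ⊆ ℝ^d × ℝ` over `P`, in terms of the facet presentation. -/
def coneOver {d m : ℕ} (n : Fin m → Fin d → ℤ) (h : Fin m → ℤ) :
    Set ((Fin d → ℝ) × ℝ) :=
  {p | ∀ i, pairing (n i) p.1 ≥ -(p.2 * (h i : ℝ))}

/-- The interior `int(C_P)` of the cone over `P`. -/
def intCone {d m : ℕ} (n : Fin m → Fin d → ℤ) (h : Fin m → ℤ) :
    Set ((Fin d → ℝ) × ℝ) :=
  {p | ∀ i, pairing (n i) p.1 > -(p.2 * (h i : ℝ))}

/-- The anticanonical set `ant(C_P)` of the cone over `P`. -/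
def antCone {d m : ℕ} (n : Fin m → Fin d → ℤ) (h : Fin m → ℤ) :
    Set ((Fin d → ℝ) × ℝ) :=
  {p | ∀ i, pairing (n i) p.1 ≥ -(p.2 * (h i : ℝ)) - 1}

/-- Lattice points of `ℝ^d × ℝ = ℝ^{d+1}`. -/
def latticePairs (d : ℕ) : Set ((Fin d → ℝ) × ℝ) :=
  {p | p.1 ∈ latticePoints d ∧ ∃ z : ℤ, p.2 = (z : ℝ)}

/-- The nearly Gorenstein condition with respect to a given facet presentation:
`(C_P ∩ ℤ^{d+1}) \ {0} ⊆ (int(C_P) ∩ ℤ^{d+1}) + (ant(C_P) ∩ ℤ^{d+1})`. -/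
def NGIncl {d m : ℕ} (n : Fin m → Fin d → ℤ) (h : Fin m → ℤ) : Prop :=
  (coneOver n h ∩ latticePairs d) \ {(0 : (Fin d → ℝ) × ℝ)} ⊆
    (intCone n h ∩ latticePairs d) + (antCone n h ∩ latticePairs d)

/-- A full-dimensional lattice polytope is nearly Gorenstein if the nearly
Gorenstein inclusion holds for its facet presentation. -/
def NearlyGorenstein {d : ℕ} (P : Set (Fin d → ℝ)) : Prop :=
  ∃ (m : ℕ) (n : Fin m → Fin d → ℤ) (h : Fin m → ℤ),
    IsFacetPresentation P n h ∧ NGIncl n h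

/-- The polar dual `Q* = {y | y(x) ≥ -1 for all x ∈ Q}`. -/
def polarDual {d : ℕ} (Q : Set (Fin d → ℝ)) : Set (Fin d → ℝ) :=
  {y | ∀ x ∈ Q, (∑ i, y i * x i) ≥ -1}

/-- A reflexive polytope: a lattice polytope with `0` in its interior whose
polar dual is again a lattice polytope. -/
def IsReflexive {d : ℕ} (Q : Set (Fin d → ℝ)) : Prop :=
  IsLatticePolytope Q ∧ (0 : Fin d → ℝ) ∈ interior Q ∧
    IsLatticePolytope (polarDual Q)

/-- A Gorenstein polytope: some dilate `kP`, translated by a lattice vector,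
is reflexive. -/
def IsGorenstein {d : ℕ} (P : Set (Fin d → ℝ)) : Prop :=
  ∃ (k : ℕ) (w : Fin d → ℝ), 1 ≤ k ∧ w ∈ latticePoints d ∧
    IsReflexive ((fun x => x - w) '' ((k : ℝ) • P))

/-- The integer decomposition property. -/
def IsIDP {d : ℕ} (P : Set (Fin d → ℝ)) : Prop :=
  ∀ k : ℕ, 1 ≤ k → ∀ x ∈ ((k : ℝ) • P) ∩ latticePoints d,
    ∃ y : Fin k → Fin d → ℝ, (∀ j, y j ∈ P ∩ latticePoints d) ∧ x = ∑ j, y j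

/-- Minkowski indecomposability of a lattice polytope. -/
def IsIndecomposable {d : ℕ} (P : Set (Fin d → ℝ)) : Prop :=
  (¬ ∃ p : Fin d → ℝ, P = {p}) ∧
  ∀ P₁ P₂ : Set (Fin d → ℝ), IsLatticePolytope P₁ → IsLatticePolytope P₂ →
    P = P₁ + P₂ → (∃ p, P₁ = {p}) ∨ (∃ p, P₂ = {p})

/-- A `(0,1)`-polytope: the convex hull of a set of `(0,1)`-vectors. -/
def Is01Polytope {d : ℕ} (P : Set (Fin d → ℝ)) : Prop :=
  ∃ V : Finset (Fin d → ℝ), (∀ v ∈ V, ∀ i, v i = 0 ∨ v i = 1) ∧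
    P = convexHull ℝ (V : Set (Fin d → ℝ))

/-- Pigeonhole: simultaneous approximation of reals by integers with a common multiplier. -/
theorem exists_nat_mul_near_int {ι : Type*} [Fintype ι] (α : ι → ℝ) {ε : ℝ} (hε : 0 < ε) :
    ∃ k : ℕ, 1 ≤ k ∧ ∃ p : ι → ℤ, ∀ i, |(k : ℝ) * α i - p i| < ε := by
  obtain ⟨N, hN⟩ := exists_nat_gt (1 / ε)
  have hN0 : (0 : ℝ) < N := lt_trans (by positivity) hN
  have hNε : 1 / (N : ℝ) < ε := by
    rw [div_lt_iff₀ hN0]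
    rw [div_lt_iff₀ hε] at hN
    linarith
  have hlt : ∀ (j : ℕ) (i : ι), ⌊Int.fract ((j : ℝ) * α i) * N⌋₊ < N := fun j i => by
    rw [Nat.floor_lt (mul_nonneg (Int.fract_nonneg _) hN0.le)]
    nlinarith [Int.fract_lt_one ((j : ℝ) * α i)]
  obtain ⟨a, b, hab, heq⟩ := Finite.exists_ne_map_eq_of_infinite
    (fun (j : ℕ) (i : ι) => (⟨_, hlt j i⟩ : Fin N))
  wlog hlt' : a < b generalizing a b
  · exact this b a hab.symm heq.symm (by omega)
  refine ⟨b - a, by omega, fun i => ⌊(b : ℝ) * α i⌋ - ⌊(a : ℝ) * α i⌋, fun i => ?_⟩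
  refine lt_of_le_of_lt ?_ hNε
  have hi : ⌊Int.fract ((a : ℝ) * α i) * N⌋₊ = ⌊Int.fract ((b : ℝ) * α i) * N⌋₊ :=
    congrArg Fin.val (congrFun heq i)
  have h1 := Nat.floor_le (mul_nonneg (Int.fract_nonneg ((a : ℝ) * α i)) hN0.le)
  have h2 := Nat.lt_floor_add_one (Int.fract ((a : ℝ) * α i) * N)
  have h3 := Nat.floor_le (mul_nonneg (Int.fract_nonneg ((b : ℝ) * α i)) hN0.le)
  have h4 := Nat.lt_floor_add_one (Int.fract ((b : ℝ) * α i) * N)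
  rw [hi] at h1 h2
  rw [Nat.cast_sub hlt'.le]
  push_cast
  have e : ((b : ℝ) - a) * α i - (⌊(b : ℝ) * α i⌋ - ⌊(a : ℝ) * α i⌋)
      = Int.fract ((b : ℝ) * α i) - Int.fract ((a : ℝ) * α i) := by
    unfold Int.fract; ring
  rw [e, abs_le, ← neg_div, div_le_iff₀ hN0, le_div_iff₀ hN0]
  constructor <;> linarith

/-- A point of the standard simplex, scaled by some `k + 1/2`, dominates an integer point with
coordinate sum `k ≥ 1`; the domination is strict wherever the integer point is positive. -/
theorem exists_int_below_of_mem_stdSimplex {ι : Type*} [Fintype ι] {α : ι → ℝ}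
    (hα : α ∈ stdSimplex ℝ ι) :
    ∃ (k : ℕ) (p : ι → ℤ), 1 ≤ k ∧ ∑ i, p i = k ∧
      ∀ i, (p i : ℝ) < (k + 1 / 2) * α i ∨ p i ≤ 0 := by
  obtain ⟨δ, hδ, hδα⟩ : ∃ δ : ℝ, 0 < δ ∧ ∀ i, 0 < α i → δ < α i := by
    have : ∀ᶠ δ in nhdsWithin (0 : ℝ) (Ioi 0), ∀ i, 0 < α i → δ < α i := by
      refine Filter.eventually_all.2 fun i => ?_
      by_cases h : 0 < α i
      · filter_upwards [nhdsWithin_le_nhds (Iio_mem_nhds h)] with δ hδ _ using hδ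
      · exact Filter.Eventually.of_forall fun _ h' => absurd h' h
    obtain ⟨δ, h1, h2⟩ := (this.and self_mem_nhdsWithin).exists
    exact ⟨δ, h2, h1⟩
  have hn : (0 : ℝ) < Fintype.card ι + 1 := by positivity
  obtain ⟨k, hk, p, hp⟩ := exists_nat_mul_near_int α
    (ε := min (δ / 2) (1 / (Fintype.card ι + 1))) (by positivity)
  refine ⟨k, p, hk, ?_, fun i => ?_⟩
  · have h1 : |(k : ℝ) - ∑ i, (p i : ℝ)| < 1 := by
      calc |(k : ℝ) - ∑ i, (p i : ℝ)| = |∑ i, ((k : ℝ) * α i - p i)| := by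
            rw [Finset.sum_sub_distrib, ← Finset.mul_sum, hα.2, mul_one]
        _ ≤ ∑ i, |(k : ℝ) * α i - p i| := Finset.abs_sum_le_sum_abs _ _
        _ ≤ ∑ _i : ι, 1 / ((Fintype.card ι : ℝ) + 1) :=
            Finset.sum_le_sum fun i _ => (hp i).le.trans (min_le_right _ _)
        _ < 1 := by
            rw [Finset.sum_const, Finset.card_univ, nsmul_eq_mul, mul_one_div, div_lt_one hn]
            linarith
    have h2 : |(k : ℤ) - ∑ i, p i| < 1 := by exact_mod_cast h1
    have := Int.abs_lt_one_iff.1 h2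
    omega
  · have hi := abs_lt.1 ((hp i).trans_le (min_le_left _ _))
    rcases (hα.1 i).lt_or_eq with h | h
    · left
      linarith [hδα i h]
    · right
      have h1 : (p i : ℝ) < 1 := by
        have := abs_lt.1 ((hp i).trans_le (min_le_right _ _))
        have h3 : 1 / ((Fintype.card ι : ℝ) + 1) ≤ 1 := by
          rw [div_le_one hn]
          linarith [(Nat.cast_nonneg (Fintype.card ι) : (0 : ℝ) ≤ _)]
        rw [← h, mul_zero] at this
        linarith
      have : p i < 1 := by exact_mod_cast h1
      omega

/-- Uniform version over the standard simplices with at most `N` vertices. -/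
theorem exists_bound_int_below_stdSimplex (N : ℕ) :
    ∃ K : ℕ, ∀ (ι : Type) [Fintype ι], Fintype.card ι ≤ N → ∀ α ∈ stdSimplex ℝ ι,
      ∃ (k : ℕ) (p : ι → ℤ), 1 ≤ k ∧ k ≤ K ∧ ∑ i, p i = k ∧
        ∀ i, (p i : ℝ) ≤ (k + 1 / 2) * α i := by
  have key : ∀ n : ℕ, ∃ K : ℕ, ∀ α ∈ stdSimplex ℝ (Fin n),
      ∃ (k : ℕ) (p : Fin n → ℤ), 1 ≤ k ∧ k ≤ K ∧ ∑ i, p i = k ∧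
        ∀ i, (p i : ℝ) ≤ (k + 1 / 2) * α i := by
    intro n
    let J := {q : ℕ × (Fin n → ℤ) // 1 ≤ q.1 ∧ ∑ i, q.2 i = q.1}
    let U : J → Set (Fin n → ℝ) := fun q =>
      {α | ∀ i, (q.1.2 i : ℝ) < (q.1.1 + 1 / 2) * α i ∨ q.1.2 i ≤ 0}
    have hU : ∀ q, IsOpen (U q) := fun q => by
      simp only [U, Set.ofPred_forall, Set.ofPred_or]
      refine isOpen_iInter_of_finite fun i => IsOpen.union ?_ isOpen_const
      exact isOpen_lt (by fun_prop) (by fun_prop)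
    obtain ⟨t, ht⟩ := (isCompact_stdSimplex ℝ (Fin n)).elim_finite_subcover U hU
      fun α hα => by
        obtain ⟨k, p, hk, hp, h⟩ := exists_int_below_of_mem_stdSimplex hα
        exact Set.mem_iUnion.2 ⟨⟨(k, p), hk, hp⟩, h⟩
    refine ⟨t.sup fun q => q.1.1, fun α hα => ?_⟩
    obtain ⟨q, hq, h⟩ := Set.mem_iUnion₂.1 (ht hα)
    refine ⟨q.1.1, q.1.2, q.2.1, Finset.le_sup (f := fun q : J => q.1.1) hq, q.2.2, fun i => ?_⟩
    rcases h i with h | h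
    · exact h.le
    · have : (q.1.2 i : ℝ) ≤ 0 := by exact_mod_cast h
      exact this.trans (mul_nonneg (by positivity) (hα.1 i))
  choose K hK using key
  refine ⟨(Finset.range (N + 1)).sup K, fun ι _ hι α hα => ?_⟩
  let e := Fintype.equivFin ι
  obtain ⟨k, p, hk, hkK, hp, h⟩ := hK (Fintype.card ι) (α ∘ e.symm)
    ⟨fun i => hα.1 _, by rw [← hα.2]; exact e.symm.sum_comp α⟩
  refine ⟨k, p ∘ e, hk, hkK.trans (Finset.le_sup (Finset.mem_range.2 (by omega))), ?_,
    fun i => by simpa using h (e i)⟩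
  rw [← hp]
  exact e.sum_comp p

open Matrix

/-- An integer vector viewed as a real vector. -/
def realVec {d : ℕ} (a : Fin d → ℤ) : Fin d → ℝ := fun i => (a i : ℝ)

theorem realVec_dotProduct {d : ℕ} (a b : Fin d → ℤ) :
    realVec a ⬝ᵥ realVec b = ((a ⬝ᵥ b : ℤ) : ℝ) := by
  simp [realVec, dotProduct]

theorem realVec_injective (d : ℕ) : Function.Injective (realVec (d := d)) := fun a b hab => by
  funext i
  exact Int.cast_injective (congrFun hab i)

/-- Positive convex combinations of at most `d + 1` points representing a point of a hull. -/
theorem exists_pos_combination_of_mem_convexHull {d : ℕ} {s : Set (Fin d → ℝ)}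
    {x : Fin d → ℝ} (hx : x ∈ convexHull ℝ s) :
    ∃ (ι : Type) (_ : Fintype ι) (z : ι → Fin d → ℝ) (w : ι → ℝ),
      Fintype.card ι ≤ d + 1 ∧ (∀ i, z i ∈ s) ∧ (∀ i, 0 < w i) ∧ ∑ i, w i = 1 ∧
        ∑ i, w i • z i = x := by
  obtain ⟨ι, hι, z, w, hz, haff, hw, hw1, hwz⟩ := eq_pos_convex_span_of_mem_convexHull hx
  refine ⟨ι, hι, z, w, ?_, fun i => hz ⟨i, rfl⟩, hw, hw1, hwz⟩
  have h1 := haff.card_le_finrank_succ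
  have h2 := Submodule.finrank_le (vectorSpan ℝ (Set.range z))
  rw [Module.finrank_fin_fun] at h2
  omega

/-- An integer functional that is nonnegative on all the points `X v` vanishes. -/
theorem eq_zero_of_forall_dotProduct_nonneg {d m : ℕ} {n : Fin m → Fin d → ℤ} {V : Type*}
    {X : V → Fin d → ℤ} {y : Fin d → ℤ}
    (hcone : ∃ v, (0 : Fin d → ℝ) ∈ convexHull ℝ
      (insert (-realVec y) {z | ∃ i, n i ⬝ᵥ X v = -1 ∧ z = realVec (n i)}))
    (hy : ∀ v, 0 ≤ y ⬝ᵥ X v) : y = 0 := by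
  obtain ⟨v, hv⟩ := hcone
  obtain ⟨ι, _, z, w, -, hz, hw, hw1, hwz⟩ := exists_pos_combination_of_mem_convexHull hv
  have hyv : (0 : ℝ) ≤ realVec y ⬝ᵥ realVec (X v) := by
    rw [realVec_dotProduct]
    exact_mod_cast hy v
  have hact : ∀ {i}, n i ⬝ᵥ X v = -1 → realVec (n i) ⬝ᵥ realVec (X v) = -1 := fun {i} hi => by
    rw [realVec_dotProduct, hi]
    norm_num
  have hle : ∀ i, w i * (z i ⬝ᵥ realVec (X v)) ≤ 0 := fun i => by
    refine mul_nonpos_of_nonneg_of_nonpos (hw i).le ?_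
    rcases hz i with h | ⟨j, hj, h⟩
    · rw [h, neg_dotProduct]
      linarith
    · rw [h, hact hj]
      norm_num
  have hsum : ∑ i, w i * (z i ⬝ᵥ realVec (X v)) = 0 := by
    have := congrArg (· ⬝ᵥ realVec (X v)) hwz
    simpa [sum_dotProduct] using this
  have hall := (Finset.sum_eq_zero_iff_of_nonpos fun i _ => hle i).1 hsum
  have hzy : ∀ i, z i = -realVec y := fun i => by
    rcases hz i with h | ⟨j, hj, h⟩
    · exact h
    · have := hall i (Finset.mem_univ i)
      rw [h, hact hj] at this
      linarith [hw i]
  simp only [hzy, ← Finset.sum_smul, hw1, one_smul, neg_eq_zero] at hwz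
  exact realVec_injective d (hwz.trans (by funext i; simp [realVec]))

/-- The number of facets of a reflexive polytope, in the form of a system of integer normals `n i`
and lattice points `X v` with `n i ⬝ᵥ X v ≥ -1`, is bounded in terms of the dimension. The second
hypothesis says that each functional lies in the cone generated by the normals active at some
`X v`. -/
theorem exists_bound_card_normals (d : ℕ) :
    ∃ c : ℕ, ∀ (m : ℕ) (n : Fin m → Fin d → ℤ) (V : Type) (X : V → Fin d → ℤ),
      Function.Injective n → (∀ i v, -1 ≤ n i ⬝ᵥ X v) →
      (∀ y : Fin d → ℤ, ∃ v, (0 : Fin d → ℝ) ∈ convexHull ℝ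
        (insert (-realVec y) {z | ∃ i, n i ⬝ᵥ X v = -1 ∧ z = realVec (n i)})) →
      m ≤ c := by
  obtain ⟨K, hK⟩ := exists_bound_int_below_stdSimplex (d + 1)
  refine ⟨(K + 2) ^ d, fun m n V X hinj hge hcone => ?_⟩
  have hle : ∀ i v, n i ⬝ᵥ X v ≤ K := by
    intro i₀ v
    by_contra! hlt
    obtain ⟨v', hv'⟩ := hcone (-n i₀)
    obtain ⟨ι, _, z, w, hcard, hz, hw, hw1, hwz⟩ := exists_pos_combination_of_mem_convexHull hv'
    have hz' : ∀ i, ∃ j, z i = realVec (n j) ∧ (j = i₀ ∨ n j ⬝ᵥ X v' = -1) := fun i => by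
      rcases hz i with h | ⟨j, hj, h⟩
      · exact ⟨i₀, by rw [h]; funext l; simp [realVec], Or.inl rfl⟩
      · exact ⟨j, h, Or.inr hj⟩
    choose j hzj hj using hz'
    obtain ⟨k, p, hk, hkK, hp, hpw⟩ := hK ι hcard w ⟨fun i => (hw i).le, hw1⟩
    have hwX : ∀ u, ∑ i, w i * ((n (j i) ⬝ᵥ X u : ℤ) : ℝ) = 0 := fun u => by
      have := congrArg (· ⬝ᵥ realVec (X u)) hwz
      simpa [sum_dotProduct, hzj, realVec_dotProduct] using this
    have hgeR : ∀ i u, (-1 : ℝ) ≤ ((n i ⬝ᵥ X u : ℤ) : ℝ) := fun i u => by exact_mod_cast hge i u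
    -- the integer combination with coefficients `p` vanishes
    have hzero : -∑ i, p i • n (j i) = 0 := by
      refine eq_zero_of_forall_dotProduct_nonneg (hcone _) fun u => ?_
      have h1 : (-1 / 2 : ℝ) ≤ ∑ i, ((k + 1 / 2) * w i - p i) * ((n (j i) ⬝ᵥ X u : ℤ) : ℝ) := by
        calc (-1 / 2 : ℝ) = ∑ i, ((k + 1 / 2) * w i - p i) * (-1) := by
              rw [← Finset.sum_mul, Finset.sum_sub_distrib, ← Finset.mul_sum, hw1]
              have : ∑ i, (p i : ℝ) = k := by exact_mod_cast hp
              rw [this]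
              ring
          _ ≤ _ := Finset.sum_le_sum fun i _ =>
              mul_le_mul_of_nonneg_left (hgeR _ _) (sub_nonneg.2 (hpw i))
      have h2 : ∑ i, ((k + 1 / 2) * w i - p i) * ((n (j i) ⬝ᵥ X u : ℤ) : ℝ) =
          (((-∑ i, p i • n (j i)) ⬝ᵥ X u : ℤ) : ℝ) := by
        simp only [sub_mul, Finset.sum_sub_distrib, mul_assoc, ← Finset.mul_sum, hwX u, mul_zero,
          zero_sub, neg_dotProduct, sum_dotProduct, smul_dotProduct, smul_eq_mul]
        push_cast
        rfl
      rw [h2] at h1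
      have h3 : (-1 : ℝ) < (((-∑ i, p i • n (j i)) ⬝ᵥ X u : ℤ) : ℝ) := by linarith
      have : -1 < (-∑ i, p i • n (j i)) ⬝ᵥ X u := by exact_mod_cast h3
      omega
    have hp0 : ∀ i, j i = i₀ → p i ≤ 0 := fun i hi => by
      have hone : ∑ l, w l * (((n (j l) ⬝ᵥ X v : ℤ) : ℝ) + 1) = 1 := by
        simp [mul_add, Finset.sum_add_distrib, hwX v, hw1]
      have h1 : w i * (((n (j i) ⬝ᵥ X v : ℤ) : ℝ) + 1) ≤ 1 :=
        (Finset.single_le_sum (f := fun l => w l * (((n (j l) ⬝ᵥ X v : ℤ) : ℝ) + 1))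
          (fun l _ => mul_nonneg (hw l).le (by linarith [hgeR (j l) v]))
          (Finset.mem_univ i)).trans_eq hone
      rw [hi] at h1
      have h2 : (K : ℝ) < ((n i₀ ⬝ᵥ X v : ℤ) : ℝ) := by exact_mod_cast hlt
      have h3 : (k : ℝ) ≤ K := by exact_mod_cast hkK
      have h4 : (p i : ℝ) < 1 := by nlinarith [hpw i, hw i]
      have : p i < 1 := by exact_mod_cast h4
      omega
    have hsum : ∑ i, p i * (n (j i) ⬝ᵥ X v' + 1) = k := by
      have := congrArg (· ⬝ᵥ X v') hzero
      simp only [neg_dotProduct, sum_dotProduct, smul_dotProduct, smul_eq_mul, zero_dotProduct,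
        neg_eq_zero] at this
      simp [mul_add, Finset.sum_add_distrib, this, hp]
    have : ∑ i, p i * (n (j i) ⬝ᵥ X v' + 1) ≤ 0 := Finset.sum_nonpos fun i _ => by
      rcases hj i with h | h
      · exact mul_nonpos_of_nonpos_of_nonneg (hp0 i h) (by linarith [hge (j i) v'])
      · simp [h]
    omega
  obtain ⟨b, hb, hspan, hlin⟩ := exists_linearIndependent ℝ (Set.range fun v => realVec (X v))
  have : Fintype b := hlin.setFinite.fintype
  have hbcard : Fintype.card b ≤ d := by
    simpa using hlin.fintype_card_le_finrank
  classical
  let S : Finset ℝ := (Finset.Icc (-1 : ℤ) K).image (fun a : ℤ => (a : ℝ))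
  have hS : S.card ≤ K + 2 := Finset.card_image_le.trans (by simp)
  have hmem : ∀ i, (fun x : b => realVec (n i) ⬝ᵥ x.1) ∈ Fintype.piFinset fun _ : b => S :=
    fun i => Fintype.mem_piFinset.2 fun x => by
      obtain ⟨v, hv⟩ := hb x.2
      simp only [← hv, realVec_dotProduct, S]
      exact Finset.mem_image_of_mem _ (Finset.mem_Icc.2 ⟨hge i v, hle i v⟩)
  have hinj' : Function.Injective fun (i : Fin m) (x : b) => realVec (n i) ⬝ᵥ x.1 := by
    intro i₁ i₂ h12
    refine hinj (sub_eq_zero.1 (eq_zero_of_forall_dotProduct_nonneg (hcone (n i₁ - n i₂))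
      fun v => ?_))
    have hspan_eq : ∀ x ∈ Submodule.span ℝ b, realVec (n i₁) ⬝ᵥ x = realVec (n i₂) ⬝ᵥ x := by
      intro x hx
      induction hx using Submodule.span_induction with
      | mem x hx => exact congrFun h12 ⟨x, hx⟩
      | zero => simp
      | add x y _ _ hx hy => rw [dotProduct_add, dotProduct_add, hx, hy]
      | smul a x _ hx => rw [dotProduct_smul, dotProduct_smul, hx]
    have heq := hspan_eq (realVec (X v)) (hspan ▸ Submodule.subset_span ⟨v, rfl⟩)
    rw [realVec_dotProduct, realVec_dotProduct, Int.cast_inj] at heq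
    rw [sub_dotProduct, heq, sub_self]
  calc m = (Finset.univ : Finset (Fin m)).card := by simp
    _ ≤ (Fintype.piFinset fun _ : b => S).card :=
        Finset.card_le_card_of_injOn _ (fun i _ => hmem i) hinj'.injOn
    _ = S.card ^ Fintype.card b := by simp
    _ ≤ (K + 2) ^ Fintype.card b := Nat.pow_le_pow_left hS _
    _ ≤ (K + 2) ^ d := Nat.pow_le_pow_right (by omega) hbcard

/-- A linear functional attains its minimum over a polytope at one of the generators. -/
theorem exists_mem_forall_dotProduct_le {d : ℕ} {V : Finset (Fin d → ℝ)} (hV : V.Nonempty)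
    (y : Fin d → ℝ) :
    ∃ v ∈ V, ∀ x ∈ convexHull ℝ (V : Set (Fin d → ℝ)), y ⬝ᵥ v ≤ y ⬝ᵥ x := by
  obtain ⟨v, hv, hmin⟩ := V.exists_min_image (y ⬝ᵥ ·) hV
  refine ⟨v, hv, fun x hx => ?_⟩
  have hconv : Convex ℝ {x : Fin d → ℝ | y ⬝ᵥ v ≤ y ⬝ᵥ x} :=
    convex_halfSpace_ge ⟨dotProduct_add y, fun c x => dotProduct_smul c y x⟩ _
  exact convexHull_min (fun u hu => hmin u hu) hconv hx

/-- Every functional lies in the normal cone of some generator of the polytope. -/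
theorem exists_zero_mem_convexHull_active {d m : ℕ} {V : Finset (Fin d → ℝ)} (hV : V.Nonempty)
    {n : Fin m → Fin d → ℤ} {h : Fin m → ℤ}
    (hP : convexHull ℝ (V : Set (Fin d → ℝ)) = {x | ∀ i, pairing (n i) x ≥ -(h i : ℝ)})
    (y : Fin d → ℝ) :
    ∃ v ∈ V, (0 : Fin d → ℝ) ∈ convexHull ℝ
      (insert (-y) {z | ∃ i, pairing (n i) v = -(h i : ℝ) ∧ z = realVec (n i)}) := by
  obtain ⟨v, hv, hmin⟩ := exists_mem_forall_dotProduct_le hV y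
  refine ⟨v, hv, ?_⟩
  by_contra hnot
  have hfin : (insert (-y) {z | ∃ i, pairing (n i) v = -(h i : ℝ) ∧ z = realVec (n i)}).Finite :=
    ((Set.finite_range fun i => realVec (n i)).subset
      (by rintro _ ⟨i, -, rfl⟩; exact ⟨i, rfl⟩)).insert _
  obtain ⟨f, u, hu, hf⟩ := geometric_hahn_banach_point_closed (convex_convexHull ℝ _)
    (hfin.isClosed_convexHull ℝ) hnot
  rw [map_zero] at hu
  let z : Fin d → ℝ := fun i => f (Pi.single i 1)
  have hfz : ∀ x, f x = x ⬝ᵥ z := fun x => by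
    conv_lhs => rw [pi_eq_sum_univ' x]
    simp [z, dotProduct]
  have hpos : ∀ x ∈ insert (-y) {z | ∃ i, pairing (n i) v = -(h i : ℝ) ∧ z = realVec (n i)},
      0 < x ⬝ᵥ z := fun x hx => by
    rw [← hfz]
    exact hu.trans (hf x (subset_convexHull ℝ _ hx))
  have hvP : v ∈ {x | ∀ i, pairing (n i) x ≥ -(h i : ℝ)} := hP ▸ subset_convexHull ℝ _ hv
  have hev : ∀ᶠ ε in nhdsWithin (0 : ℝ) (Ioi 0), ∀ i,
      realVec (n i) ⬝ᵥ (v + ε • z) ≥ -(h i : ℝ) := by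
    refine Filter.eventually_all.2 fun i => ?_
    rcases (hvP i).lt_or_eq with hlt | heq
    · have hc : ContinuousAt (fun ε : ℝ => realVec (n i) ⬝ᵥ (v + ε • z)) 0 := by
        simp only [dotProduct_add, dotProduct_smul, smul_eq_mul]
        fun_prop
      have := hc.eventually_const_lt (u := -(h i : ℝ)) (by
        beta_reduce
        rw [zero_smul, add_zero]
        exact hlt)
      filter_upwards [nhdsWithin_le_nhds this] with ε hε using le_of_lt hε
    · filter_upwards [self_mem_nhdsWithin] with ε hε
      have h1 : 0 < realVec (n i) ⬝ᵥ z := hpos _ (Or.inr ⟨i, heq.symm, rfl⟩)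
      have h2 : realVec (n i) ⬝ᵥ v = -(h i : ℝ) := heq.symm
      rw [dotProduct_add, dotProduct_smul, h2, smul_eq_mul]
      nlinarith [mul_pos (show (0 : ℝ) < ε from hε) h1]
  obtain ⟨ε, hε, hε0⟩ := (hev.and self_mem_nhdsWithin).exists
  have hmem : v + ε • z ∈ convexHull ℝ (V : Set (Fin d → ℝ)) := by
    rw [hP]
    exact hε
  have h1 := hmin _ hmem
  have h2 := hpos (-y) (Or.inl rfl)
  rw [dotProduct_add, dotProduct_smul, smul_eq_mul] at h1
  rw [neg_dotProduct] at h2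
  nlinarith [mul_pos (show (0 : ℝ) < ε from hε0) h2]

/-- The normals of a facet presentation are pairwise distinct. -/
theorem IsFacetPresentation.injective {d m : ℕ} {P : Set (Fin d → ℝ)} {n : Fin m → Fin d → ℤ}
    {h : Fin m → ℤ} (hF : IsFacetPresentation P n h) : Function.Injective n := by
  intro i j hij
  by_contra hne
  obtain ⟨x, hx1, hx2⟩ := hF.2.2 i
  obtain ⟨y, hy1, hy2⟩ := hF.2.2 j
  have h1 := hx2 j (Ne.symm hne)
  have h2 := hy2 i hne
  rw [hij] at hx1 h2
  linarith

theorem mem_latticePoints_iff {d : ℕ} {x : Fin d → ℝ} :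
    x ∈ latticePoints d ↔ ∃ a, x = realVec a := by
  constructor
  · intro hx
    choose a ha using hx
    exact ⟨a, funext ha⟩
  · rintro ⟨a, rfl⟩ i
    exact ⟨a i, rfl⟩

/-- A lattice point of the interior of the cone over a polytope has positive height. -/
theorem pos_of_mem_intCone {d m : ℕ} {V : Finset (Fin d → ℝ)} (hV : V.Nonempty)
    {n : Fin m → Fin d → ℤ} {h : Fin m → ℤ} (i₀ : Fin m)
    (hP : convexHull ℝ (V : Set (Fin d → ℝ)) = {x | ∀ i, pairing (n i) x ≥ -(h i : ℝ)})
    {p : (Fin d → ℝ) × ℝ} (hp : p ∈ intCone n h) : 0 < p.2 := by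
  by_contra! hle
  have hVP : ∀ v ∈ V, ∀ i, realVec (n i) ⬝ᵥ v ≥ -(h i : ℝ) := fun v hv =>
    (hP ▸ subset_convexHull ℝ _ hv : v ∈ {x | ∀ i, pairing (n i) x ≥ -(h i : ℝ)})
  obtain ⟨u, hu⟩ := hV
  have hz : ∀ i, 0 < realVec (n i) ⬝ᵥ (p.1 - p.2 • u) := fun i => by
    have h1 : realVec (n i) ⬝ᵥ p.1 > -(p.2 * (h i : ℝ)) := hp i
    rw [dotProduct_sub, dotProduct_smul, smul_eq_mul]
    nlinarith [hVP u hu i]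
  obtain ⟨v, hv, hmin⟩ := exists_mem_forall_dotProduct_le ⟨u, hu⟩ (-(p.1 - p.2 • u))
  have hmem : v + (p.1 - p.2 • u) ∈ convexHull ℝ (V : Set (Fin d → ℝ)) := by
    rw [hP]
    intro i
    change realVec (n i) ⬝ᵥ _ ≥ _
    rw [dotProduct_add]
    linarith [hVP v hv i, hz i]
  have h1 := hmin _ hmem
  rw [dotProduct_add, neg_dotProduct _ (p.1 - p.2 • u)] at h1
  have h2 : p.1 - p.2 • u = 0 :=
    dotProduct_self_eq_zero.1 (le_antisymm (by linarith) (Finset.sum_nonneg fun i _ => mul_self_nonneg _))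
  have h3 := hz i₀
  rw [h2, dotProduct_zero] at h3
  exact lt_irrefl _ h3

/-- In a nearly Gorenstein polytope, every lattice point `v` gives a lattice point at height at
least `-1` over all facet directions, with equality for the facets through `v`. -/
theorem NGIncl.exists_lattice_vertex {d m : ℕ} {V : Finset (Fin d → ℝ)} (hV : V.Nonempty)
    {n : Fin m → Fin d → ℤ} {h : Fin m → ℤ}
    (hP : convexHull ℝ (V : Set (Fin d → ℝ)) = {x | ∀ i, pairing (n i) x ≥ -(h i : ℝ)})
    (hNG : NGIncl n h) {v : Fin d → ℝ} (hvL : v ∈ latticePoints d) (hvV : v ∈ V) :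
    ∃ a : Fin d → ℤ, ∀ i, -1 ≤ n i ⬝ᵥ a ∧ (pairing (n i) v = -(h i : ℝ) → n i ⬝ᵥ a = -1) := by
  rcases isEmpty_or_nonempty (Fin m) with hm | ⟨⟨i₀⟩⟩
  · exact ⟨0, fun i => isEmptyElim i⟩
  have hvP : v ∈ {x | ∀ i, pairing (n i) x ≥ -(h i : ℝ)} := hP ▸ subset_convexHull ℝ _ hvV
  have hmem : ((v, 1) : (Fin d → ℝ) × ℝ) ∈ (coneOver n h ∩ latticePairs d) \ {0} := by
    refine ⟨⟨fun i => by simpa using hvP i, hvL, 1, by simp⟩, fun h0 => ?_⟩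
    exact one_ne_zero (congrArg Prod.snd h0)
  obtain ⟨p, ⟨hp, hpL, k, hk⟩, q, ⟨hq, hqL, -⟩, hpq⟩ := hNG hmem
  have hk1 : 1 ≤ k := by
    have := pos_of_mem_intCone hV i₀ hP hp
    rw [hk] at this
    exact_mod_cast this
  obtain ⟨a, ha⟩ := mem_latticePoints_iff.1 hvL
  obtain ⟨b, hb⟩ := mem_latticePoints_iff.1 hqL
  have hk1' : (1 : ℝ) ≤ k := by exact_mod_cast hk1
  have hsum1 : p.1 + q.1 = v := congrArg Prod.fst hpq
  have hsum2 : p.2 + q.2 = 1 := congrArg Prod.snd hpq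
  have hval : ∀ i, ((n i ⬝ᵥ ((k - 1) • a + b) : ℤ) : ℝ)
      = (k - 1) * (realVec (n i) ⬝ᵥ v) + realVec (n i) ⬝ᵥ q.1 := fun i => by
    rw [ha, hb, realVec_dotProduct, realVec_dotProduct, dotProduct_add, dotProduct_smul]
    push_cast
    simp
  have hq' : ∀ i, realVec (n i) ⬝ᵥ q.1 ≥ -(q.2 * (h i : ℝ)) - 1 := hq
  have hq2 : q.2 = 1 - k := by linarith
  have hge : ∀ i, -1 ≤ n i ⬝ᵥ ((k - 1) • a + b) := fun i => by
    have h1 : realVec (n i) ⬝ᵥ v ≥ -(h i : ℝ) := hvP i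
    have h2 := hq' i
    have : (-1 : ℝ) ≤ ((n i ⬝ᵥ ((k - 1) • a + b) : ℤ) : ℝ) := by
      rw [hval]
      rw [hq2] at h2
      nlinarith
    exact_mod_cast this
  refine ⟨(k - 1) • a + b, fun i => ⟨hge i, fun hi => le_antisymm ?_ (hge i)⟩⟩
  have h1 : realVec (n i) ⬝ᵥ v = -(h i : ℝ) := hi
  have h2 : realVec (n i) ⬝ᵥ p.1 > -(p.2 * (h i : ℝ)) := hp i
  have h3 : realVec (n i) ⬝ᵥ p.1 + realVec (n i) ⬝ᵥ q.1 = realVec (n i) ⬝ᵥ v := by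
    rw [← dotProduct_add, hsum1]
  have : ((n i ⬝ᵥ ((k - 1) • a + b) : ℤ) : ℝ) < 0 := by
    rw [hval, h1]
    rw [hk] at h2
    nlinarith
  have : n i ⬝ᵥ ((k - 1) • a + b) < 0 := by exact_mod_cast this
  omega

theorem stmt_13 (d : ℕ) (hd : 1 ≤ d) :
    ∃ c : ℕ, ∀ P : Set (Fin d → ℝ), IsLatticePolytope P → (interior P).Nonempty →
      ∀ (m : ℕ) (n : Fin m → Fin d → ℤ) (h : Fin m → ℤ),
        IsFacetPresentation P n h → NGIncl n h → m ≤ c := by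
  obtain ⟨c, hc⟩ := exists_bound_card_normals d
  refine ⟨c, ?_⟩
  rintro _ ⟨V, hVL, rfl⟩ hint m n h hF hNG
  have hV : V.Nonempty := by
    have := hint.mono interior_subset
    rw [convexHull_nonempty_iff] at this
    exact_mod_cast this
  choose X hX using fun v : {v // v ∈ V} =>
    NGIncl.exists_lattice_vertex hV hF.1 hNG (hVL v.2) v.2
  refine hc m n {v // v ∈ V} X hF.injective (fun i v => (hX v i).1) fun y => ?_
  obtain ⟨v, hv, h0⟩ := exists_zero_mem_convexHull_active hV hF.1 (realVec y)
  refine ⟨⟨v, hv⟩, convexHull_mono (Set.insert_subset_insert ?_) h0⟩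
  rintro _ ⟨i, hi, rfl⟩
  exact ⟨i, (hX ⟨v, hv⟩ i).2 hi, rfl⟩
end

section
/- Let P ⊆ ℝ^d be a full-dimensional IDP (0,1)-polytope. Then P is nearly Gorenstein if and only if there exist a permutation σ of the coordinates of ℝ^d, positive integers d_1, …, d_s with d_1 + ⋯ + d_s = d, and Gorenstein full-dimensional (0,1)-polytopes P_i ⊆ ℝ^{d_i} (i = 1, …, s) such that the image of P under σ equals the direct product P_1 × ⋯ × P_s and the codegrees satisfy |a_{P_i} − a_{P_j}| ≤ 1 for all 1 ≤ i < j ≤ s. -/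
open Set Pointwise

/-- The pairing with a fixed integral functional, as a continuous linear map. -/
def pairingCLM {d : ℕ} (n : Fin d → ℤ) : (Fin d → ℝ) →L[ℝ] ℝ :=
  ∑ i, (n i : ℝ) • ContinuousLinearMap.proj i

lemma pairingCLM_apply {d : ℕ} (n : Fin d → ℤ) (x : Fin d → ℝ) :
    pairingCLM n x = pairing n x := by
  simp [pairingCLM, pairing]

lemma pairing_add {d : ℕ} (n : Fin d → ℤ) (x y : Fin d → ℝ) :
    pairing n (x + y) = pairing n x + pairing n y := by
  simp only [← pairingCLM_apply, map_add]

lemma pairing_sub {d : ℕ} (n : Fin d → ℤ) (x y : Fin d → ℝ) :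
    pairing n (x - y) = pairing n x - pairing n y := by
  simp only [← pairingCLM_apply, map_sub]

lemma pairing_smul {d : ℕ} (n : Fin d → ℤ) (c : ℝ) (x : Fin d → ℝ) :
    pairing n (c • x) = c * pairing n x := by
  simp only [← pairingCLM_apply, map_smul, smul_eq_mul]

lemma pairing_zero {d : ℕ} (n : Fin d → ℤ) : pairing n 0 = 0 := by
  simp only [← pairingCLM_apply, map_zero]

lemma pairing_sum {d : ℕ} {ι : Type*} (s : Finset ι) (n : Fin d → ℤ) (y : ι → Fin d → ℝ) :
    pairing n (∑ j ∈ s, y j) = ∑ j ∈ s, pairing n (y j) := by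
  simp only [← pairingCLM_apply, map_sum]

lemma pairing_single {d : ℕ} (n : Fin d → ℤ) (j : Fin d) :
    pairing n (Pi.single j 1) = n j := by
  simp [pairing, Pi.single_apply]

lemma continuous_pairing {d : ℕ} (n : Fin d → ℤ) : Continuous (pairing n) := by
  exact (pairingCLM n).continuous.congr (pairingCLM_apply n)

lemma pairing_congr {d : ℕ} {n : Fin d → ℤ} {x y : Fin d → ℝ}
    (hxy : ∀ j, n j ≠ 0 → x j = y j) : pairing n x = pairing n y := by
  refine Finset.sum_congr rfl fun j _ => ?_
  by_cases hj : n j = 0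
  · simp [hj]
  · rw [hxy j hj]

lemma convex_pairing_ge {d : ℕ} (n : Fin d → ℤ) (b : ℝ) : Convex ℝ {x | pairing n x ≥ b} := by
  simp only [← pairingCLM_apply]
  exact convex_halfSpace_ge (pairingCLM n).isLinear b

lemma convex_pairing_gt {d : ℕ} (n : Fin d → ℤ) (b : ℝ) : Convex ℝ {x | pairing n x > b} := by
  simp only [← pairingCLM_apply]
  exact convex_halfSpace_gt (pairingCLM n).isLinear b

lemma exists_int_pairing {d : ℕ} (n : Fin d → ℤ) {x : Fin d → ℝ} (hx : x ∈ latticePoints d) :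
    ∃ z : ℤ, pairing n x = z := by
  choose y hy using hx
  exact ⟨∑ i, n i * y i, by simp [pairing, hy]⟩

lemma latticePoints_add {d : ℕ} {x y : Fin d → ℝ} (hx : x ∈ latticePoints d)
    (hy : y ∈ latticePoints d) : x + y ∈ latticePoints d := fun i => by
  obtain ⟨a, ha⟩ := hx i
  obtain ⟨b, hb⟩ := hy i
  exact ⟨a + b, by simp [ha, hb]⟩

lemma latticePoints_sub {d : ℕ} {x y : Fin d → ℝ} (hx : x ∈ latticePoints d)
    (hy : y ∈ latticePoints d) : x - y ∈ latticePoints d := fun i => by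
  obtain ⟨a, ha⟩ := hx i
  obtain ⟨b, hb⟩ := hy i
  exact ⟨a - b, by simp [ha, hb]⟩

lemma latticePoints_natCast_smul {d : ℕ} {x : Fin d → ℝ} (hx : x ∈ latticePoints d) (k : ℕ) :
    (k : ℝ) • x ∈ latticePoints d := fun i => by
  obtain ⟨a, ha⟩ := hx i
  exact ⟨k * a, by simp [ha]⟩

lemma interior_halfSpaces {d : ℕ} {ι : Type*} [Finite ι] {n : ι → Fin d → ℤ}
    (hn : ∀ i, n i ≠ 0) (b : ι → ℝ) :
    interior {x | ∀ i, pairing (n i) x ≥ b i} = {x | ∀ i, pairing (n i) x > b i} := by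
  have key : ∀ i, interior {x | pairing (n i) x ≥ b i} = {x | pairing (n i) x > b i} := by
    intro i
    have hne : pairingCLM (n i) ≠ 0 := fun h0 => hn i <| funext fun j => by
      have := pairing_single (n i) j
      rw [← pairingCLM_apply, h0] at this
      simpa using this.symm
    have ho := (pairingCLM (n i)).isOpenMap_of_ne_zero hne
    have := ho.preimage_interior_eq_interior_preimage (pairingCLM (n i)).continuous (Ici (b i))
    rw [interior_Ici] at this
    ext x
    have hx := Set.ext_iff.1 this x
    simp only [Set.mem_preimage, mem_Ioi, pairingCLM_apply] at hx
    rw [mem_ofPred_eq, gt_iff_lt, hx]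
    simp only [Set.preimage, mem_Ici, pairingCLM_apply, ge_iff_le]
  rw [ofPred_forall, interior_iInter_of_finite, ofPred_forall]
  simp only [key]

/-- A bounded full-dimensional set cut out by finitely many integral half-spaces. -/
structure IsHalfSpacePresentation {d : ℕ} {ι : Type*} (P : Set (Fin d → ℝ))
    (n : ι → Fin d → ℤ) (h : ι → ℤ) : Prop where
  eq : P = {x | ∀ i, pairing (n i) x ≥ -(h i : ℝ)}
  ne_zero : ∀ i, n i ≠ 0
  bounded : Bornology.IsBounded P
  interior_nonempty : (interior P).Nonempty

namespace IsHalfSpacePresentation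

variable {d : ℕ} {ι : Type*} {P : Set (Fin d → ℝ)} {n : ι → Fin d → ℤ} {h : ι → ℤ}

lemma mem_iff (H : IsHalfSpacePresentation P n h) {x : Fin d → ℝ} :
    x ∈ P ↔ ∀ i, pairing (n i) x ≥ -(h i : ℝ) := by
  rw [H.eq]
  rfl

lemma natCast_smul_eq (H : IsHalfSpacePresentation P n h) {k : ℕ} (hk : 1 ≤ k) :
    (k : ℝ) • P = {x | ∀ i, pairing (n i) x ≥ -((k : ℝ) * h i)} := by
  have hk' : (0 : ℝ) < k := by exact_mod_cast hk
  ext x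
  rw [mem_smul_set_iff_inv_smul_mem₀ hk'.ne', H.mem_iff]
  refine forall_congr' fun i => ?_
  rw [pairing_smul, ge_iff_le, ge_iff_le, inv_mul_eq_div, le_div_iff₀ hk']
  rw [neg_mul, mul_comm]

lemma interior_natCast_smul_eq [Finite ι] (H : IsHalfSpacePresentation P n h) {k : ℕ}
    (hk : 1 ≤ k) :
    interior ((k : ℝ) • P) = {x | ∀ i, pairing (n i) x > -((k : ℝ) * h i)} := by
  rw [H.natCast_smul_eq hk, interior_halfSpaces H.ne_zero]

lemma exists_interior [Finite ι] (H : IsHalfSpacePresentation P n h) :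
    ∃ p ∈ P, ∀ i, pairing (n i) p > -(h i : ℝ) := by
  obtain ⟨p, hp⟩ := H.interior_nonempty
  refine ⟨p, interior_subset hp, ?_⟩
  rwa [H.eq, interior_halfSpaces H.ne_zero] at hp

/-- A bounded set has no nonzero recession direction. -/
lemma eq_zero_of_pairing_nonneg (H : IsHalfSpacePresentation P n h) {y : Fin d → ℝ}
    (hy : ∀ i, pairing (n i) y ≥ 0) : y = 0 := by
  by_contra hne
  obtain ⟨p, hp⟩ := H.interior_nonempty.mono interior_subset
  obtain ⟨C, hC⟩ := H.bounded.exists_norm_le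
  have hmem : ∀ t : ℝ, 0 ≤ t → p + t • y ∈ P := fun t ht => H.mem_iff.2 fun i => by
    rw [pairing_add, pairing_smul]
    have h1 := H.mem_iff.1 hp i
    have h2 := mul_nonneg ht (hy i)
    linarith
  have hpos : 0 < ‖y‖ := norm_pos_iff.2 hne
  have hC0 : 0 ≤ C := (norm_nonneg p).trans (hC p hp)
  have ht : 0 ≤ (2 * C + 1) / ‖y‖ := by positivity
  have h1 := hC _ (hmem _ ht)
  have h2 : ‖((2 * C + 1) / ‖y‖) • y‖ = 2 * C + 1 := by
    rw [norm_smul, Real.norm_of_nonneg ht, div_mul_cancel₀ _ hpos.ne']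
  have h3 : ‖((2 * C + 1) / ‖y‖) • y‖ ≤ ‖p + ((2 * C + 1) / ‖y‖) • y‖ + ‖p‖ := by
    simpa using norm_sub_le (p + ((2 * C + 1) / ‖y‖) • y) p
  linarith [hC p hp]

lemma nonempty_index (H : IsHalfSpacePresentation P n h) (hd : 1 ≤ d) : Nonempty ι := by
  by_contra hι
  rw [not_nonempty_iff] at hι
  have := congrFun (H.eq_zero_of_pairing_nonneg (y := Pi.single ⟨0, hd⟩ 1) hι.elim) ⟨0, hd⟩
  simp at this

/-- The cone over a polytope meets the non-positive heights only in the origin. -/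
lemma eq_zero_of_height_nonpos [Finite ι] (H : IsHalfSpacePresentation P n h) (hd : 1 ≤ d)
    {y : Fin d → ℝ} {k : ℝ} (hk : k ≤ 0) (hy : ∀ i, pairing (n i) y + k * h i ≥ 0) :
    k = 0 ∧ y = 0 := by
  obtain ⟨p, -, hp⟩ := H.exists_interior
  have hz : ∀ i, pairing (n i) (y - k • p) ≥ (-k) * (pairing (n i) p + h i) := fun i => by
    rw [pairing_sub, pairing_smul]
    linarith [hy i]
  have h0 := H.eq_zero_of_pairing_nonneg fun i =>
    (mul_nonneg (neg_nonneg.2 hk) (by linarith [hp i])).trans (hz i)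
  obtain ⟨i⟩ := H.nonempty_index hd
  have hk0 : k = 0 := by
    by_contra hne
    have hlt : 0 < -k := neg_pos.2 (lt_of_le_of_ne hk hne)
    have h1 := hz i
    rw [h0, pairing_zero] at h1
    have h2 := mul_pos hlt (show 0 < pairing (n i) p + h i by linarith [hp i])
    linarith
  exact ⟨hk0, by simpa [hk0] using h0⟩

end IsHalfSpacePresentation

lemma Is01Polytope.isLatticePolytope {d : ℕ} {P : Set (Fin d → ℝ)} (hP : Is01Polytope P) :
    IsLatticePolytope P := by
  obtain ⟨V, hV, rfl⟩ := hP
  refine ⟨V, fun v hv i => ?_, rfl⟩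
  rcases hV v hv i with h0 | h0
  · exact ⟨0, by simp [h0]⟩
  · exact ⟨1, by simp [h0]⟩

lemma IsLatticePolytope.isBounded {d : ℕ} {P : Set (Fin d → ℝ)} (hP : IsLatticePolytope P) :
    Bornology.IsBounded P := by
  obtain ⟨V, -, rfl⟩ := hP
  exact isBounded_convexHull.2 V.finite_toSet.isBounded

lemma IsLatticePolytope.image_smul_sub {d : ℕ} {P : Set (Fin d → ℝ)} (hP : IsLatticePolytope P)
    (k : ℕ) {w : Fin d → ℝ} (hw : w ∈ latticePoints d) :
    IsLatticePolytope ((fun x => x - w) '' ((k : ℝ) • P)) := by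
  classical
  obtain ⟨V, hV, rfl⟩ := hP
  refine ⟨V.image fun v => (k : ℝ) • v - w, ?_, ?_⟩
  · intro x hx
    obtain ⟨v, hv, rfl⟩ := Finset.mem_image.1 (Finset.mem_coe.1 hx)
    exact latticePoints_sub (latticePoints_natCast_smul (hV hv) k) hw
  · have := AffineMap.image_convexHull
      ((k : ℝ) • AffineMap.id ℝ (Fin d → ℝ) - AffineMap.const ℝ _ w) (V : Set (Fin d → ℝ))
    rw [Finset.coe_image, ← image_smul, image_image]
    exact this
/-- Strict separation of a point from a closed convex set, in coordinates. -/
lemma exists_dot_separation {d : ℕ} {C : Set (Fin d → ℝ)} (hC : Convex ℝ C) (hcl : IsClosed C)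
    {x : Fin d → ℝ} (hx : x ∉ C) :
    ∃ (y : Fin d → ℝ) (c : ℝ), ∑ i, y i * x i < c ∧ ∀ q ∈ C, c < ∑ i, y i * q i := by
  obtain ⟨f, c, hfx, hfC⟩ := geometric_hahn_banach_point_closed hC hcl hx
  have hf : ∀ z, f z = ∑ i, f (Pi.single i 1) * z i := fun z => by
    have := LinearMap.pi_apply_eq_sum_univ (f : (Fin d → ℝ) →ₗ[ℝ] ℝ) z
    simp only [ContinuousLinearMap.coe_coe, smul_eq_mul] at this
    rw [this]
    refine Finset.sum_congr rfl fun i _ => ?_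
    rw [mul_comm]
    congr 2
    ext j
    simp [Pi.single_apply, eq_comm]
  refine ⟨fun i => f (Pi.single i 1), c, ?_, fun q hq => ?_⟩
  · rw [← hf]
    exact hfx
  · rw [← hf]
    exact hfC q hq

lemma convex_dot_ge {d : ℕ} (x : Fin d → ℝ) (b : ℝ) : 
    Convex ℝ {y : Fin d → ℝ | ∑ i, y i * x i ≥ b} := by
  refine convex_halfSpace_ge (f := fun y : Fin d → ℝ => ∑ i, y i * x i)
    ⟨fun y z => ?_, fun c y => ?_⟩ b
  · simp [add_mul, Finset.sum_add_distrib]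
  · simp [Finset.mul_sum, mul_assoc]

lemma polarDual_halfSpaces {d : ℕ} {ι : Type*} [Finite ι] (n : ι → Fin d → ℤ) :
    polarDual {x | ∀ i, pairing (n i) x ≥ -1} =
      convexHull ℝ (insert 0 (range fun i j => (n i j : ℝ))) := by
  apply Subset.antisymm
  · intro y hy
    by_contra hne
    obtain ⟨x, c, hxy, hxC⟩ := exists_dot_separation (convex_convexHull ℝ _)
      (Set.Finite.isClosed_convexHull (𝕜 := ℝ) ((finite_range _).insert 0)) hne
    have hc : c < 0 := by simpa using hxC 0 (subset_convexHull ℝ _ (mem_insert _ _))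
    have hmem : (-c)⁻¹ • x ∈ {x | ∀ i, pairing (n i) x ≥ -1} := fun i => by
      have h1 := hxC (fun j => (n i j : ℝ))
        (subset_convexHull ℝ _ (mem_insert_of_mem _ (mem_range_self i)))
      have h2 : pairing (n i) x = ∑ j, x j * (n i j : ℝ) :=
        Finset.sum_congr rfl fun j _ => mul_comm _ _
      rw [pairing_smul, h2, inv_mul_eq_div, ge_iff_le, le_div_iff₀ (neg_pos.2 hc)]
      linarith
    have h3 := hy _ hmem
    have h4 : ∑ i, y i * ((-c)⁻¹ • x) i = (∑ i, x i * y i) / (-c) := by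
      rw [Finset.sum_div]
      refine Finset.sum_congr rfl fun i _ => ?_
      simp only [Pi.smul_apply, smul_eq_mul]
      ring
    rw [h4, ge_iff_le, le_div_iff₀ (neg_pos.2 hc)] at h3
    linarith
  · intro y hy x hx
    refine convexHull_min (t := {y | ∑ i, y i * x i ≥ -1}) ?_ (convex_dot_ge x _) hy
    rintro _ (rfl | ⟨i, rfl⟩)
    · simp
    · exact hx i

lemma eq_halfSpaces_of_polarDual {d : ℕ} {C V : Set (Fin d → ℝ)} (hC : Convex ℝ C)
    (hcl : IsClosed C) (h0 : 0 ∈ C) (hV : polarDual C = convexHull ℝ V) :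
    C = {x | ∀ y ∈ V, ∑ i, y i * x i ≥ -1} := by
  apply Subset.antisymm
  · intro x hx y hy
    have : y ∈ polarDual C := hV ▸ subset_convexHull ℝ _ hy
    exact this x hx
  · intro x hx
    by_contra hne
    obtain ⟨y, c, hyx, hyC⟩ := exists_dot_separation hC hcl hne
    have hc : c < 0 := by simpa using hyC 0 h0
    have hsum : ∀ q : Fin d → ℝ, ∑ i, ((-c)⁻¹ • y) i * q i = (∑ i, y i * q i) / (-c) := by
      intro q
      rw [Finset.sum_div]
      refine Finset.sum_congr rfl fun i _ => ?_
      simp only [Pi.smul_apply, smul_eq_mul]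
      ring
    have hmem : (-c)⁻¹ • y ∈ polarDual C := fun q hq => by
      rw [hsum, ge_iff_le, le_div_iff₀ (neg_pos.2 hc)]
      linarith [hyC q hq]
    rw [hV] at hmem
    have := convexHull_min (t := {y | ∑ i, y i * x i ≥ -1}) hx (convex_dot_ge x _) hmem
    rw [mem_ofPred_eq, hsum, ge_iff_le, le_div_iff₀ (neg_pos.2 hc)] at this
    linarith

/-- A polytope whose facets all have lattice distance one from `w` at height `a` is Gorenstein. -/
lemma IsHalfSpacePresentation.isGorenstein {d : ℕ} {ι : Type*} [Finite ι] {P : Set (Fin d → ℝ)}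
    {n : ι → Fin d → ℤ} {h : ι → ℤ} (H : IsHalfSpacePresentation P n h)
    (hP : IsLatticePolytope P) {a : ℕ} (ha : 1 ≤ a) {w : Fin d → ℝ} (hw : w ∈ latticePoints d)
    (hwn : ∀ i, pairing (n i) w + a * h i = 1) : IsGorenstein P := by
  have heq : (fun x => x - w) '' ((a : ℝ) • P) = {x | ∀ i, pairing (n i) x ≥ -1} := by
    rw [H.natCast_smul_eq ha]
    ext x
    constructor
    · rintro ⟨y, hy, rfl⟩ i
      have := hy i
      rw [pairing_sub]
      linarith [hwn i]
    · intro hx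
      refine ⟨x + w, fun i => ?_, by simp⟩
      have := hx i
      rw [pairing_add]
      linarith [hwn i]
  refine ⟨a, w, ha, hw, hP.image_smul_sub a hw, ?_, ?_⟩
  · rw [heq, interior_halfSpaces H.ne_zero]
    intro i
    rw [pairing_zero]
    norm_num
  · rw [heq, polarDual_halfSpaces]
    classical
    refine ⟨((finite_range fun i j => (n i j : ℝ)).insert 0).toFinset, ?_, by simp⟩
    rw [Set.Finite.coe_toFinset]
    rintro _ (rfl | ⟨i, rfl⟩) j
    · exact ⟨0, by simp⟩
    · exact ⟨n i j, rfl⟩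

lemma IsHalfSpacePresentation.isCodegree {d : ℕ} {ι : Type*} [Finite ι] {P : Set (Fin d → ℝ)}
    {n : ι → Fin d → ℤ} {h : ι → ℤ} (H : IsHalfSpacePresentation P n h) (hd : 1 ≤ d)
    {a : ℕ} (ha : 1 ≤ a) {w : Fin d → ℝ} (hw : w ∈ latticePoints d)
    (hwn : ∀ i, pairing (n i) w + a * h i = 1) : IsCodegree P a := by
  refine ⟨ha, ⟨w, ?_, hw⟩, fun k hk => ?_⟩
  · rw [H.interior_natCast_smul_eq ha]
    intro i
    linarith [hwn i]
  · rintro ⟨u, hu, hul⟩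
    rw [H.interior_natCast_smul_eq hk] at hu
    by_contra hlt
    have hlt' : (k : ℝ) < a := by exact_mod_cast not_le.1 hlt
    have key := H.eq_zero_of_height_nonpos hd (y := u - w) (k := k - a) (by linarith) fun i => by
      obtain ⟨z, hz⟩ := exists_int_pairing (n i) hul
      have h1 : pairing (n i) u > -((k : ℝ) * h i) := hu i
      have h2 : pairing (n i) u ≥ -((k : ℝ) * h i) + 1 := by
        rw [hz] at h1 ⊢
        exact_mod_cast h1
      rw [pairing_sub]
      linarith [hwn i]
    linarith [key.1]

lemma IsCodegree.unique {d : ℕ} {P : Set (Fin d → ℝ)} {a b : ℕ} (ha : IsCodegree P a)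
    (hb : IsCodegree P b) : a = b :=
  le_antisymm (ha.2.2 b hb.1 hb.2.1) (hb.2.2 a ha.1 ha.2.1)

/-- If `kP - w` is reflexive then `P` is cut out by primitive integral half-spaces whose
boundaries all have lattice distance one from `w` at height `k`. -/
lemma exists_halfSpaces_of_isReflexive {d : ℕ} {P : Set (Fin d → ℝ)} (hP : IsLatticePolytope P)
    {k : ℕ} (hk : 1 ≤ k) {w : Fin d → ℝ} (hw : w ∈ latticePoints d)
    (hR : IsReflexive ((fun x => x - w) '' ((k : ℝ) • P))) :
    ∃ (S : Finset (Fin d → ℤ)) (h : (Fin d → ℤ) → ℤ),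
      P = {x | ∀ n ∈ S, pairing n x ≥ -(h n : ℝ)} ∧
      ∀ n ∈ S, Finset.univ.gcd n = 1 ∧ pairing n w + k * h n = 1 := by
  classical
  obtain ⟨V, hV, rfl⟩ := hP
  obtain ⟨⟨V₁, -, hV₁⟩, h0, ⟨V₂, hV₂, hdual⟩⟩ := hR
  have hk' : (0 : ℝ) < k := by exact_mod_cast hk
  set Q := (fun x => x - w) '' ((k : ℝ) • convexHull ℝ (V : Set (Fin d → ℝ))) with hQ
  have hQeq : Q = {x | ∀ y ∈ (V₂ : Set (Fin d → ℝ)), ∑ i, y i * x i ≥ -1} :=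
    eq_halfSpaces_of_polarDual (hV₁ ▸ convex_convexHull ℝ _)
      (hV₁ ▸ V₁.finite_toSet.isClosed_convexHull (𝕜 := ℝ)) (interior_subset h0) hdual
  have hround : ∀ y ∈ V₂, ∀ x, pairing (fun i => ⌊y i⌋) x = ∑ i, y i * x i := by
    intro y hy x
    refine Finset.sum_congr rfl fun i _ => ?_
    obtain ⟨z, hz⟩ := hV₂ hy i
    simp [hz]
  set S : Finset (Fin d → ℤ) := (V₂.image fun y i => ⌊y i⌋).erase 0 with hS
  have hQS : Q = {x | ∀ n ∈ S, pairing n x ≥ -1} := by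
    rw [hQeq]
    ext x
    constructor
    · intro hx n hn
      obtain ⟨y, hy, rfl⟩ := Finset.mem_image.1 (Finset.mem_of_mem_erase hn)
      rw [hround y hy]
      exact hx y hy
    · intro hx y hy
      rw [← hround y hy]
      by_cases hn : (fun i => ⌊y i⌋) = (0 : Fin d → ℤ)
      · rw [hn]
        simp [pairing]
      · exact hx _ (Finset.mem_erase.2 ⟨hn, Finset.mem_image_of_mem _ hy⟩)
  have hmemQ : ∀ x, x ∈ convexHull ℝ (V : Set (Fin d → ℝ)) ↔ (k : ℝ) • x - w ∈ Q := by
    intro x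
    constructor
    · intro hx
      exact ⟨_, smul_mem_smul_set hx, rfl⟩
    · rintro ⟨_, ⟨y, hy, rfl⟩, hyx⟩
      have : (k : ℝ) • y = (k : ℝ) • x := sub_left_injective hyx
      rwa [← smul_right_injective _ hk'.ne' this]
  have hvert : ∀ n ∈ S, ∃ v ∈ V, pairing n ((k : ℝ) • v - w) < 0 := by
    intro n hn
    by_contra! hcon
    have hsub : Q ⊆ {x | ∀ _ : Unit, pairing n x ≥ 0} := by
      rintro _ ⟨_, ⟨x, hx, rfl⟩, rfl⟩ -
      have h1 : x ∈ {x | pairing n x ≥ (k : ℝ)⁻¹ * pairing n w} := by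
        refine convexHull_min (fun v hv => ?_) (convex_pairing_ge n _) hx
        have := hcon v hv
        rw [pairing_sub, pairing_smul] at this
        rw [mem_ofPred_eq, ge_iff_le, inv_mul_le_iff₀ hk']
        linarith
      rw [mem_ofPred_eq, ge_iff_le, inv_mul_le_iff₀ hk'] at h1
      change pairing n ((k : ℝ) • x - w) ≥ 0
      rw [pairing_sub, pairing_smul]
      linarith
    have h1 := interior_mono hsub h0
    rw [interior_halfSpaces (n := fun _ : Unit => n) fun _ => (Finset.mem_erase.1 hn).1] at h1
    have h2 := h1 ()
    rw [pairing_zero] at h2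
    exact lt_irrefl _ h2
  choose! v hvV hv using hvert
  have hval : ∀ n ∈ S, pairing n ((k : ℝ) • v n - w) = -1 := by
    intro n hn
    have hlat := latticePoints_sub (latticePoints_natCast_smul (hV (hvV n hn)) k) hw
    obtain ⟨z, hz⟩ := exists_int_pairing n hlat
    have h1 := hv n hn
    have h2 : (k : ℝ) • v n - w ∈ Q := (hmemQ _).1 (subset_convexHull ℝ _ (hvV n hn))
    rw [hQS] at h2
    have h3 := h2 n hn
    rw [hz] at h1 h3 ⊢
    have h4 : z < 0 := by exact_mod_cast h1
    have h5 : -1 ≤ z := by exact_mod_cast h3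
    have h6 : z = -1 := by omega
    simp [h6]
  have hint : ∀ n ∈ S, ∃ z : ℤ, pairing n (v n) = z := fun n hn =>
    exists_int_pairing n (hV (hvV n hn))
  choose! z hz using hint
  have hone : ∀ n ∈ S, pairing n w + k * ((-z n : ℤ) : ℝ) = 1 := by
    intro n hn
    have := hval n hn
    rw [pairing_sub, pairing_smul, hz n hn] at this
    push_cast
    linarith
  refine ⟨S, fun n => -z n, ?_, fun n hn => ⟨?_, hone n hn⟩⟩
  · ext x
    rw [hmemQ, hQS]
    refine forall₂_congr fun n hn => ?_
    have h1 := hone n hn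
    rw [pairing_sub, pairing_smul]
    constructor
    · intro h2
      refine le_of_mul_le_mul_left (a := (k : ℝ)) ?_ hk'
      linarith
    · intro h2
      have := mul_le_mul_of_nonneg_left h2 hk'.le
      linarith
  · have hlat := latticePoints_sub (latticePoints_natCast_smul (hV (hvV n hn)) k) hw
    choose y hy using hlat
    have h1 := hval n hn
    have h2 : ∑ i, n i * y i = -1 := by
      have : (((∑ i, n i * y i : ℤ)) : ℝ) = -1 := by
        rw [← h1]
        simp only [pairing, hy, Int.cast_sum, Int.cast_mul]
      exact_mod_cast this
    have h3 : Finset.univ.gcd n ∣ 1 := by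
      have : Finset.univ.gcd n ∣ ∑ i, n i * y i :=
        Finset.dvd_sum fun i _ => (Finset.gcd_dvd (Finset.mem_univ i)).mul_right _
      rw [h2] at this
      exact (dvd_neg.1 this)
    rw [← Finset.normalize_gcd]
    exact normalize_eq_one.2 (isUnit_of_dvd_one h3)

/-- The coordinates are weighted by `c`, each normal is supported on coordinates of a common
weight, and at that weight, as height, its facet has lattice distance one from `w`. -/
def IsSplitting {d : ℕ} {ι : Type*} (n : ι → Fin d → ℤ) (h : ι → ℤ) (c : Fin d → ℕ)
    (w : Fin d → ℝ) : Prop :=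
  ∀ F, ∃ j₀, (∀ j, n F j ≠ 0 → c j = c j₀) ∧ pairing (n F) w + c j₀ * h F = 1

/-- An integrally closed polytope with a splitting by almost equal heights is nearly Gorenstein. -/
lemma IsSplitting.ngIncl {d m : ℕ} {P : Set (Fin d → ℝ)} {n : Fin m → Fin d → ℤ} {h : Fin m → ℤ}
    {c : Fin d → ℕ} {w : Fin d → ℝ} (hS : IsSplitting n h c w)
    (H : IsHalfSpacePresentation P n h) (hd : 1 ≤ d) (hidp : IsIDP P)
    (hw : w ∈ latticePoints d) (hc : ∀ i j, c i ≤ c j + 1) : NGIncl n h := by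
  rintro ⟨x, t⟩ ⟨⟨hx, hxl, z, hz⟩, hne⟩
  have hx' : ∀ i, pairing (n i) x ≥ -(t * (h i : ℝ)) := hx
  obtain rfl : t = z := hz
  have hz1 : 1 ≤ z := by
    by_contra hlt
    have hz0 : (z : ℝ) ≤ 0 := by exact_mod_cast (by omega : z ≤ 0)
    obtain ⟨h1, h2⟩ := H.eq_zero_of_height_nonpos hd hz0 (y := x) fun i => by linarith [hx' i]
    exact hne (by rw [h1, h2]; rfl)
  lift z to ℕ using by omega with k
  have hk : 1 ≤ k := by exact_mod_cast hz1
  rw [Int.cast_natCast] at hx' ⊢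
  obtain ⟨y, hy, hxy⟩ := hidp k hk x ⟨by rw [H.natCast_smul_eq hk]; exact hx', hxl⟩
  let y₀ := y ⟨0, hk⟩
  have hrest : ∀ i, pairing (n i) (x - y₀) ≥ -(((k : ℝ) - 1) * h i) := by
    intro i
    have h1 : x - y₀ = ∑ j ∈ Finset.univ.erase ⟨0, hk⟩, y j := by
      rw [hxy, ← Finset.add_sum_erase _ _ (Finset.mem_univ (⟨0, hk⟩ : Fin k)), add_sub_cancel_left]
    have h2 := Finset.card_nsmul_le_sum (Finset.univ.erase (⟨0, hk⟩ : Fin k))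
      (fun j => pairing (n i) (y j)) (-(h i : ℝ)) fun j _ => H.mem_iff.1 (hy j).1 i
    rw [Finset.card_erase_of_mem (Finset.mem_univ _), Finset.card_univ, Fintype.card_fin,
      nsmul_eq_mul, Nat.cast_sub hk, Nat.cast_one] at h2
    rw [h1, pairing_sum]
    linarith
  have : Nonempty (Fin d) := ⟨⟨0, hd⟩⟩
  obtain ⟨j₁, hj₁⟩ := Finite.exists_max c
  let u : Fin d → ℝ := fun j => if c j = c j₁ then w j else w j + y₀ j
  have hul : u ∈ latticePoints d := fun j => by
    by_cases hj : c j = c j₁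
    · simpa [u, hj] using hw j
    · simpa [u, hj] using latticePoints_add hw (hy ⟨0, hk⟩).2 j
  have key : ∀ i, pairing (n i) u ≥ -((c j₁ : ℝ) * h i) + 1 ∧
      pairing (n i) (x - u) ≥ -(((k : ℝ) - c j₁) * h i) - 1 := by
    intro i
    obtain ⟨j₀, hsupp, hval⟩ := hS i
    by_cases hj : c j₀ = c j₁
    · have h1 : pairing (n i) u = pairing (n i) w := pairing_congr fun j hnj => by
        simp [u, (hsupp j hnj).trans hj]
      rw [pairing_sub, h1, ← hj]
      exact ⟨by linarith, by linarith [hx' i]⟩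
    · have h1 : pairing (n i) u = pairing (n i) (w + y₀) := pairing_congr fun j hnj => by
        simp [u, hsupp j hnj, hj]
      have h2 : c j₁ = c j₀ + 1 := by
        have := hc j₁ j₀
        have := hj₁ j₀
        omega
      have h3 := H.mem_iff.1 (hy ⟨0, hk⟩).1 i
      have h4 := hrest i
      rw [pairing_sub] at h4
      rw [pairing_sub, h1, pairing_add, h2]
      push_cast
      exact ⟨by linarith, by linarith⟩
  refine Set.mem_add.2 ⟨(u, c j₁), ⟨fun i => ?_, hul, c j₁, by simp⟩, (x - u, (k : ℝ) - c j₁),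
    ⟨fun i => (key i).2, latticePoints_sub hxl hul, k - c j₁, by simp⟩, by simp⟩
  have := (key i).1
  change pairing (n i) u > -((c j₁ : ℝ) * h i)
  linarith

lemma pairing_comp {d d' : ℕ} {τ : Fin d' → Fin d} (hτ : Function.Injective τ) {n : Fin d → ℤ}
    (hn : ∀ j, n j ≠ 0 → j ∈ range τ) (x : Fin d → ℝ) :
    pairing (n ∘ τ) (x ∘ τ) = pairing n x := by
  refine Fintype.sum_of_injective τ hτ _ _ (fun j hj => ?_) fun i => rfl
  have : n j = 0 := by
    by_contra h0
    exact hj (hn j h0)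
  simp [this]

lemma Is01Polytope.image_comp {d d' : ℕ} {P : Set (Fin d → ℝ)} (hP : Is01Polytope P)
    (τ : Fin d' → Fin d) : Is01Polytope ((fun x => x ∘ τ) '' P) := by
  classical
  obtain ⟨V, hV, rfl⟩ := hP
  refine ⟨V.image fun x => x ∘ τ, ?_, ?_⟩
  · intro v hv i
    obtain ⟨x, hx, rfl⟩ := Finset.mem_image.1 hv
    exact hV x hx (τ i)
  · rw [Finset.coe_image]
    exact (LinearMap.funLeft ℝ ℝ τ).image_convexHull _

namespace IsSplitting

variable {d d' : ℕ} {ι : Type*} {P : Set (Fin d → ℝ)} {n : ι → Fin d → ℤ} {h : ι → ℤ}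
  {c : Fin d → ℕ} {w : Fin d → ℝ}

lemma weight_pos (hS : IsSplitting n h c w) (H : IsHalfSpacePresentation P n h) (j₁ : Fin d) :
    1 ≤ c j₁ := by
  by_contra hlt
  have hq : c j₁ = 0 := by omega
  have hres : (fun j => if c j = 0 then w j else 0) = (0 : Fin d → ℝ) := by
    refine H.eq_zero_of_pairing_nonneg fun F => ?_
    obtain ⟨j₀, hsupp, hval⟩ := hS F
    by_cases hj : c j₀ = 0
    · rw [pairing_congr (y := w) fun j hnj => by simp [(hsupp j hnj).trans hj]]
      rw [hj, Nat.cast_zero, zero_mul] at hval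
      linarith
    · rw [pairing_congr (y := 0) fun j hnj => by simp [hsupp j hnj, hj], pairing_zero]
  have hsingle := H.eq_zero_of_pairing_nonneg (y := Pi.single j₁ 1) fun F => by
    obtain ⟨j₀, hsupp, hval⟩ := hS F
    rw [pairing_single]
    by_cases hnj : n F j₁ = 0
    · simp [hnj]
    · exfalso
      have hj : c j₀ = 0 := (hsupp j₁ hnj).symm.trans hq
      rw [← pairing_congr (x := fun j => if c j = 0 then w j else 0)
        fun j hnj => by simp [(hsupp j hnj).trans hj], hres, pairing_zero, hj] at hval
      simp at hval
  have := congrFun hsingle j₁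
  simp at this

/-- The projection to the coordinates of a fixed weight `q` is Gorenstein of codegree `q`. -/
lemma factor [Finite ι] (hS : IsSplitting n h c w) (H : IsHalfSpacePresentation P n h)
    (hP : Is01Polytope P) (hw : w ∈ latticePoints d) (hd' : 1 ≤ d') {τ : Fin d' → Fin d}
    (hτ : Function.Injective τ) {q : ℕ} (hq : ∀ j, c j = q ↔ j ∈ range τ) :
    Is01Polytope ((fun x => x ∘ τ) '' P) ∧ (interior ((fun x => x ∘ τ) '' P)).Nonempty ∧
      IsGorenstein ((fun x => x ∘ τ) '' P) ∧ IsCodegree ((fun x => x ∘ τ) '' P) q := by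
  let ι' := {F // ∀ j, n F j ≠ 0 → c j = q}
  have hpair : ∀ (F : ι') (x : Fin d → ℝ),
      pairing (n F ∘ τ) (x ∘ τ) = pairing (n F) x := fun F x =>
    pairing_comp hτ (fun j hj => (hq j).1 (F.2 j hj)) x
  have hne : ∀ F : ι', n F ∘ τ ≠ 0 := fun F h0 => H.ne_zero F <| funext fun j => by
    by_contra hj
    obtain ⟨i, rfl⟩ := (hq j).1 (F.2 j hj)
    exact hj (congrFun h0 i)
  have hQ : (fun x => x ∘ τ) '' P =
      {x | ∀ F : ι', pairing (n F ∘ τ) x ≥ -(h F : ℝ)} := by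
    ext x
    constructor
    · rintro ⟨y, hy, rfl⟩ F
      have := H.mem_iff.1 hy F
      rwa [← hpair] at this
    · intro hx
      obtain ⟨p, hp, -⟩ := H.exists_interior
      have hext : Function.extend τ x p ∘ τ = x := funext fun i => hτ.extend_apply x p i
      refine ⟨Function.extend τ x p, H.mem_iff.2 fun F => ?_, hext⟩
      by_cases hF : ∀ j, n F j ≠ 0 → c j = q
      · rw [← hpair ⟨F, hF⟩, hext]
        exact hx ⟨F, hF⟩
      · obtain ⟨j₀, hsupp, -⟩ := hS F
        rw [pairing_congr (y := p) fun j hnj => ?_]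
        · exact H.mem_iff.1 hp F
        · refine Function.extend_apply' _ _ _ fun hj => hF fun j' hnj' => ?_
          rw [hsupp j' hnj', ← hsupp j hnj]
          exact (hq j).2 hj
  have hint : (interior ((fun x => x ∘ τ) '' P)).Nonempty := by
    obtain ⟨p, -, hp⟩ := H.exists_interior
    refine ⟨p ∘ τ, ?_⟩
    rw [hQ, interior_halfSpaces hne]
    intro F
    rw [hpair]
    exact hp F
  have h01 := hP.image_comp τ
  have H' : IsHalfSpacePresentation ((fun x => x ∘ τ) '' P) (fun F : ι' => n F ∘ τ)
    (fun F : ι' => h F) := ⟨hQ, hne, h01.isLatticePolytope.isBounded, hint⟩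
  have hq1 : 1 ≤ q := by
    rw [← (hq (τ ⟨0, hd'⟩)).2 ⟨_, rfl⟩]
    exact hS.weight_pos H _
  have hwl : w ∘ τ ∈ latticePoints d' := fun i => hw (τ i)
  have hval : ∀ F : ι', pairing (n F ∘ τ) (w ∘ τ) + q * h F = 1 := by
    intro F
    obtain ⟨j₀, hsupp, hval⟩ := hS F
    obtain ⟨j, hj⟩ := Function.ne_iff.1 (H.ne_zero F)
    have hj₀ : c j₀ = q := (hsupp j hj).symm.trans (F.2 j hj)
    rw [hpair, ← hval, hj₀]
  exact ⟨h01, hint, H'.isGorenstein h01.isLatticePolytope hq1 hwl hval,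
    H'.isCodegree hd' hq1 hwl hval⟩

/-- A splitting decomposes the polytope as a product of Gorenstein polytopes. -/
lemma exists_product [Finite ι] (hS : IsSplitting n h c w) (H : IsHalfSpacePresentation P n h)
    (hd : 1 ≤ d) (hP : Is01Polytope P) (hw : w ∈ latticePoints d) (hc : ∀ i j, c i ≤ c j + 1) :
    ∃ (s : ℕ) (dims : Fin s → ℕ) (e : Fin d ≃ (Σ i : Fin s, Fin (dims i)))
      (Q : ∀ i : Fin s, Set (Fin (dims i) → ℝ)) (a : Fin s → ℕ),
      1 ≤ s ∧ (∀ i, 1 ≤ dims i) ∧ (∑ i, dims i = d) ∧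
      (∀ i, Is01Polytope (Q i) ∧ (interior (Q i)).Nonempty ∧
        IsGorenstein (Q i) ∧ IsCodegree (Q i) (a i)) ∧
      (∀ i j : Fin s, i < j → |(a i : ℤ) - (a j : ℤ)| ≤ 1) ∧
      (fun (x : Fin d → ℝ) => x ∘ e.symm) '' P =
        {y : (Σ i : Fin s, Fin (dims i)) → ℝ | ∀ i, (fun j => y ⟨i, j⟩) ∈ Q i} := by
  classical
  let g := (Finset.univ.image c).equivFin
  let c' : Fin d → Fin (Finset.univ.image c).card := fun j =>
    g ⟨c j, Finset.mem_image_of_mem c (Finset.mem_univ j)⟩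
  have hc' : ∀ j, ((g.symm (c' j) : Finset.univ.image c) : ℕ) = c j := fun j => by simp [c']
  have hsurj : Function.Surjective c' := fun i => by
    obtain ⟨j, -, hj⟩ := Finset.mem_image.1 (g.symm i).2
    refine ⟨j, g.symm.injective (Subtype.ext ?_)⟩
    rw [hc', hj]
  let e : Fin d ≃ Σ i, Fin (Fintype.card {j // c' j = i}) :=
    (Equiv.sigmaFiberEquiv c').symm.trans
      (Equiv.sigmaCongrRight fun i => Fintype.equivFin {j // c' j = i})
  have he : ∀ i j, c' (e.symm ⟨i, j⟩) = i := fun i j =>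
    ((Fintype.equivFin {j // c' j = i}).symm j).2
  have hdims : ∀ i, 1 ≤ Fintype.card {j // c' j = i} := fun i => by
    obtain ⟨j, hj⟩ := hsurj i
    exact Fintype.card_pos_iff.2 ⟨⟨j, hj⟩⟩
  have hrange : ∀ i j, c j = (g.symm i : Finset.univ.image c) ↔
      j ∈ range fun l => e.symm ⟨i, l⟩ := by
    intro i j
    rw [← hc' j, Subtype.coe_inj, g.symm.injective.eq_iff]
    constructor
    · rintro rfl
      exact ⟨_, e.symm_apply_apply j⟩
    · rintro ⟨l, rfl⟩
      exact he i l
  have hinj : ∀ i, Function.Injective fun l => e.symm ⟨i, l⟩ := fun i l l' hl => by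
    simpa using hl
  refine ⟨_, _, e, fun i => (fun x l => x (e.symm ⟨i, l⟩)) '' P,
    fun i => (g.symm i : Finset.univ.image c), ?_, hdims, ?_, fun i => ?_, fun i j _ => ?_, ?_⟩
  · exact Finset.card_pos.2 ⟨c ⟨0, hd⟩, Finset.mem_image_of_mem c (Finset.mem_univ _)⟩
  · simpa using (Fintype.card_congr e).symm
  · exact hS.factor H hP hw (hdims i) (hinj i) (hrange i)
  · obtain ⟨i, rfl⟩ := hsurj i
    obtain ⟨j, rfl⟩ := hsurj j
    simp only [hc', abs_le]
    have h1 := hc i j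
    have h2 := hc j i
    omega
  · ext y
    constructor
    · rintro ⟨x, hx, rfl⟩ i
      exact ⟨x, hx, rfl⟩
    · intro hy
      refine ⟨y ∘ e, H.mem_iff.2 fun F => ?_, by ext; simp⟩
      obtain ⟨j₀, hsupp, -⟩ := hS F
      obtain ⟨x, hx, hxy⟩ := hy (c' j₀)
      rw [pairing_congr (y := x) fun j hnj => ?_]
      · exact H.mem_iff.1 hx F
      · obtain ⟨l, rfl⟩ := (hrange (c' j₀) j).1 (by rw [hc', hsupp j hnj])
        simpa using (congrFun hxy l).symm

end IsSplitting

lemma IsFacetPresentation.isHalfSpacePresentation {d m : ℕ} {P : Set (Fin d → ℝ)}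
    {n : Fin m → Fin d → ℤ} {h : Fin m → ℤ} (hF : IsFacetPresentation P n h)
    (hP : Is01Polytope P) (hfull : (interior P).Nonempty) : IsHalfSpacePresentation P n h := by
  refine ⟨hF.1, fun i h0 => ?_, hP.isLatticePolytope.isBounded, hfull⟩
  have h1 := hF.2.1 i
  rw [h0, (Finset.gcd_eq_zero_iff (f := (0 : Fin d → ℤ))).2 fun _ _ => rfl] at h1
  exact zero_ne_one h1

/-- Every facet has a point lying on no other facet. -/
lemma IsFacetPresentation.exists_mem_relint {d m : ℕ} {P : Set (Fin d → ℝ)}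
    {n : Fin m → Fin d → ℤ} {h : Fin m → ℤ} (hF : IsFacetPresentation P n h)
    (H : IsHalfSpacePresentation P n h) (F : Fin m) :
    ∃ z, pairing (n F) z = -(h F : ℝ) ∧ ∀ G, G ≠ F → pairing (n G) z > -(h G : ℝ) := by
  obtain ⟨p, -, hp⟩ := H.exists_interior
  obtain ⟨x, hxF, hxG⟩ := hF.2.2 F
  have hpF := hp F
  have hpos : 0 < pairing (n F) p - pairing (n F) x := by linarith
  set t := (pairing (n F) p + h F) / (pairing (n F) p - pairing (n F) x) with ht
  have ht0 : 0 ≤ t := div_nonneg (by linarith) hpos.le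
  have ht1 : t < 1 := by
    rw [ht, div_lt_one hpos]
    linarith
  refine ⟨(1 - t) • p + t • x, ?_, fun G hG => ?_⟩
  · rw [pairing_add, pairing_smul, pairing_smul]
    have := div_mul_cancel₀ (pairing (n F) p + h F) hpos.ne'
    rw [← ht] at this
    linarith
  · rw [pairing_add, pairing_smul, pairing_smul]
    have h1 := mul_lt_mul_of_pos_left (hp G) (sub_pos.2 ht1)
    have h2 := mul_le_mul_of_nonneg_left (hxG G hG) ht0
    linarith

/-- If a polytope is a product with respect to the coordinates in `A` and the remaining ones,
then every facet normal is supported on one of the two sets of coordinates. -/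
lemma IsFacetPresentation.support_of_mix {d m : ℕ} {P : Set (Fin d → ℝ)}
    {n : Fin m → Fin d → ℤ} {h : Fin m → ℤ} (hF : IsFacetPresentation P n h)
    (H : IsHalfSpacePresentation P n h) (A : Set (Fin d)) [DecidablePred (· ∈ A)]
    (hmix : ∀ x ∈ P, ∀ y ∈ P, A.piecewise x y ∈ P) (F : Fin m) :
    (∀ j, n F j ≠ 0 → j ∈ A) ∨ (∀ j, n F j ≠ 0 → j ∉ A) := by
  by_contra! hcon
  obtain ⟨⟨b, hnb, hb⟩, a, hna, ha⟩ := hcon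
  obtain ⟨z, hzF, hzG⟩ := hF.exists_mem_relint H F
  have hzP : z ∈ P := H.mem_iff.2 fun G => by
    by_cases hG : G = F
    · rw [hG, hzF]
    · exact (hzG G hG).le
  let s : ℝ := -((n F a : ℝ) * n F b)
  let δ : Fin d → ℝ := (s * n F b) • Pi.single a 1 - (s * n F a) • Pi.single b 1
  have hδ : pairing (n F) δ = 0 := by
    rw [pairing_sub, pairing_smul, pairing_smul, pairing_single, pairing_single]
    ring
  have hcont : ∀ G, Continuous fun ε : ℝ => pairing (n G) (z + ε • δ) := fun G =>
    (continuous_pairing (n G)).comp (by fun_prop)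
  have hev : ∀ᶠ ε in nhdsWithin (0 : ℝ) (Ioi 0),
      ∀ G, G ≠ F → pairing (n G) (z + ε • δ) > -(h G : ℝ) := by
    refine nhdsWithin_le_nhds (Filter.eventually_all.2 fun G => ?_)
    by_cases hG : G = F
    · exact Filter.Eventually.of_forall fun _ h0 => absurd hG h0
    · have := ((hcont G).tendsto 0).eventually_const_lt (u := -(h G : ℝ))
        (by simpa using hzG G hG)
      exact this.mono fun _ h1 _ => h1
  obtain ⟨ε, hε, hε0⟩ := (hev.and self_mem_nhdsWithin).exists
  have hqP : z + ε • δ ∈ P := H.mem_iff.2 fun G => by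
    by_cases hG : G = F
    · rw [hG, pairing_add, pairing_smul, hδ, hzF]
      simp
    · exact (hε G hG).le
  have hpw : A.piecewise (z + ε • δ) z = z + (ε * (s * n F b)) • Pi.single a 1 := by
    ext j
    by_cases hj : j ∈ A
    · have hjb : j ≠ b := fun h0 => hb (h0 ▸ hj)
      simp [Set.piecewise, hj, δ, hjb, mul_assoc]
    · have hja : j ≠ a := fun h0 => hj (h0 ▸ ha)
      simp [Set.piecewise, hj, hja]
  have h1 := H.mem_iff.1 (hmix _ hqP _ hzP) F
  rw [hpw, pairing_add, pairing_smul, pairing_single, hzF] at h1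
  have h2 : 0 < ε * ((n F a : ℝ) * n F b) ^ 2 := by
    have h3 : (n F a : ℝ) ≠ 0 := by exact_mod_cast hna
    have h4 : (n F b : ℝ) ≠ 0 := by exact_mod_cast hnb
    have h5 : (0 : ℝ) < ε := hε0
    positivity
  have h3 : ε * (s * n F b) * n F a = -(ε * ((n F a : ℝ) * n F b) ^ 2) := by
    simp only [s]
    ring
  linarith

/-- Closure under exchanging coordinates can be checked on generators. -/
lemma piecewise_mem_of_eq_convexHull {d : ℕ} {P V : Set (Fin d → ℝ)} (hP : P = convexHull ℝ V)
    (A : Set (Fin d)) [DecidablePred (· ∈ A)] (hV : ∀ x ∈ V, ∀ y ∈ V, A.piecewise x y ∈ P)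
    {x y : Fin d → ℝ} (hx : x ∈ P) (hy : y ∈ P) : A.piecewise x y ∈ P := by
  subst hP
  have hcomb : ∀ (x x' y y' : Fin d → ℝ) (a b : ℝ),
      A.piecewise (a • x + b • x') (a • y + b • y') =
        a • A.piecewise x y + b • A.piecewise x' y' := by
    intro x x' y y' a b
    ext j
    by_cases hj : j ∈ A <;> simp [Set.piecewise, hj]
  have hself : ∀ (y : Fin d → ℝ) (a b : ℝ), a + b = 1 → a • y + b • y = y := by
    intro y a b hab
    rw [← add_smul, hab, one_smul]
  have hleft : ∀ y ∈ V, ∀ x ∈ convexHull ℝ V, A.piecewise x y ∈ convexHull ℝ V := by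
    intro y hyV x hx
    refine convexHull_min (t := {x | A.piecewise x y ∈ convexHull ℝ V})
      (fun x hx => hV x hx y hyV) ?_ hx
    intro x₁ h₁ x₂ h₂ a b ha hb hab
    have := convex_convexHull ℝ V h₁ h₂ ha hb hab
    rwa [← hcomb, hself y a b hab] at this
  refine convexHull_min (t := {y | A.piecewise x y ∈ convexHull ℝ V})
    (fun y hy => hleft y hy x hx) ?_ hy
  intro y₁ h₁ y₂ h₂ a b ha hb hab
  have := convex_convexHull ℝ V h₁ h₂ ha hb hab
  rwa [← hcomb, hself x a b hab] at this

lemma Is01Polytope.eq_zero_or_one {d : ℕ} {P : Set (Fin d → ℝ)} (hP : Is01Polytope P)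
    {x : Fin d → ℝ} (hx : x ∈ P) (hxl : x ∈ latticePoints d) (j : Fin d) : x j = 0 ∨ x j = 1 := by
  obtain ⟨V, hV, rfl⟩ := hP
  have h1 : x ∈ Icc (0 : Fin d → ℝ) 1 := by
    refine convexHull_min (t := Icc (0 : Fin d → ℝ) 1)
      (fun v hv => ⟨fun i => ?_, fun i => ?_⟩) (convex_Icc _ _) hx
    · rcases hV v hv i with h0 | h0 <;> simp [h0]
    · rcases hV v hv i with h0 | h0 <;> simp [h0]
  obtain ⟨z, hz⟩ := hxl j
  have h2 : (0 : ℝ) ≤ x j := h1.1 j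
  have h3 : x j ≤ (1 : ℝ) := h1.2 j
  rw [hz] at h2 h3 ⊢
  have h4 : 0 ≤ z := by exact_mod_cast h2
  have h5 : z ≤ 1 := by exact_mod_cast h3
  obtain h6 | h6 : z = 0 ∨ z = 1 := by omega
  · left; simp [h6]
  · right; simp [h6]

/-- Integral form of the nearly Gorenstein condition at height one. -/
lemma NGIncl.exists_decomposition {d m : ℕ} {n : Fin m → Fin d → ℤ} {h : Fin m → ℤ}
    (hNG : NGIncl n h) {v : Fin d → ℝ} (hvl : v ∈ latticePoints d)
    (hv : ∀ F, pairing (n F) v ≥ -(h F : ℝ)) :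
    ∃ (u : Fin d → ℝ) (k : ℤ), u ∈ latticePoints d ∧ (∀ F, pairing (n F) u + k * h F ≥ 1) ∧
      ∀ F, pairing (n F) (v - u) + (1 - k) * h F ≥ -1 := by
  have hmem : ((v, 1) : (Fin d → ℝ) × ℝ) ∈
      (coneOver n h ∩ latticePairs d) \ {(0 : (Fin d → ℝ) × ℝ)} := by
    refine ⟨⟨fun F => ?_, hvl, 1, by simp⟩, fun h0 => ?_⟩
    · simpa using hv F
    · have := congrArg Prod.snd (mem_singleton_iff.1 h0)
      simp at this
  obtain ⟨⟨u, t⟩, ⟨hu, hul, k, hk⟩, ⟨u', t'⟩, ⟨hu', -⟩, hadd⟩ := Set.mem_add.1 (hNG hmem)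
  obtain rfl : t = k := hk
  have h1 : u + u' = v := congrArg Prod.fst hadd
  have h2 : (k : ℝ) + t' = 1 := congrArg Prod.snd hadd
  refine ⟨u, k, hul, fun F => ?_, fun F => ?_⟩
  · have h3 : pairing (n F) u > -((k : ℝ) * h F) := hu F
    obtain ⟨z, hz⟩ := exists_int_pairing (n F) hul
    rw [hz] at h3 ⊢
    have h4 : -(k * h F) < z := by exact_mod_cast h3
    have h5 : 1 ≤ z + k * h F := by omega
    exact_mod_cast h5
  · have h3 : pairing (n F) u' ≥ -(t' * h F) - 1 := hu' F
    rw [← h1, add_sub_cancel_left, ← h2, add_sub_cancel_left]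
    linarith

/-- A nearly Gorenstein `(0,1)`-polytope splits. -/
lemma IsFacetPresentation.exists_isSplitting {d m : ℕ} {P : Set (Fin d → ℝ)}
    {n : Fin m → Fin d → ℤ} {h : Fin m → ℤ} (hF : IsFacetPresentation P n h)
    (H : IsHalfSpacePresentation P n h) (hP : Is01Polytope P) (hd : 1 ≤ d) (hNG : NGIncl n h) :
    ∃ (c : Fin d → ℕ) (w : Fin d → ℝ), w ∈ latticePoints d ∧ (∀ i j, c i ≤ c j + 1) ∧
      IsSplitting n h c w := by
  classical
  have hdec : ∀ v ∈ P ∩ latticePoints d, ∃ (u : Fin d → ℝ) (k : ℤ), u ∈ latticePoints d ∧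
      (∀ F, pairing (n F) u + k * h F ≥ 1) ∧
      ∀ F, pairing (n F) (v - u) + (1 - k) * h F ≥ -1 := fun v hv =>
    hNG.exists_decomposition hv.2 (H.mem_iff.1 hv.1)
  choose! u k hul hu hant using hdec
  have hkpos : ∀ v ∈ P ∩ latticePoints d, 1 ≤ k v := by
    intro v hv
    by_contra hlt
    have hk0 : (k v : ℝ) ≤ 0 := by exact_mod_cast (by omega : k v ≤ 0)
    obtain ⟨h1, h2⟩ := H.eq_zero_of_height_nonpos hd hk0 (y := u v) fun F => by
      linarith [hu v hv F]
    obtain ⟨F⟩ := H.nonempty_index hd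
    have := hu v hv F
    rw [h1, h2, pairing_zero] at this
    norm_num at this
  have hcross : ∀ v ∈ P ∩ latticePoints d, ∀ v' ∈ P ∩ latticePoints d, ∀ F,
      pairing (n F) (u v + (v' - u v')) + ((1 + k v - k v' : ℤ) : ℝ) * h F ≥ 0 := by
    intro v hv v' hv' F
    rw [pairing_add]
    push_cast
    linarith [hu v hv F, hant v' hv' F]
  by_cases hlt : ∃ v ∈ P ∩ latticePoints d, ∃ v' ∈ P ∩ latticePoints d, k v < k v'
  · obtain ⟨v, hv, v', hv', hlt⟩ := hlt
    obtain ⟨h1, h2⟩ := H.eq_zero_of_height_nonpos hd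
      (by exact_mod_cast (by omega : 1 + k v - k v' ≤ 0)) (hcross v hv v' hv')
    refine ⟨fun _ => (k v).toNat, u v, hul v hv, fun _ _ => Nat.le_succ _,
      fun F => ⟨⟨0, hd⟩, fun _ _ => rfl, ?_⟩⟩
    have h3 : (((k v).toNat : ℕ) : ℝ) = k v := by
      exact_mod_cast Int.toNat_of_nonneg (by linarith [hkpos v hv])
    have h4 := hant v' hv' F
    have h5 := hu v hv F
    have h6 : (k v' : ℝ) = 1 + k v := by
      push_cast at h1
      linarith
    have h7 := pairing_add (n F) (u v) (v' - u v')
    rw [h2, pairing_zero] at h7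
    rw [h6] at h4
    rw [h3]
    linarith
  push Not at hlt
  obtain ⟨V, hV01, hVP⟩ := id hP
  have hVL : ∀ v ∈ V, v ∈ P ∩ latticePoints d := fun v hv => by
    refine ⟨hVP ▸ subset_convexHull ℝ _ hv, fun i => ?_⟩
    rcases hV01 v hv i with h0 | h0
    · exact ⟨0, by simp [h0]⟩
    · exact ⟨1, by simp [h0]⟩
  obtain ⟨v₀, hv₀V⟩ : V.Nonempty := by
    obtain ⟨p, hp⟩ := H.interior_nonempty.mono interior_subset
    rw [hVP] at hp
    exact Finset.coe_nonempty.1 (convexHull_nonempty_iff.1 ⟨p, hp⟩)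
  have hv₀ := hVL v₀ hv₀V
  have hkeq : ∀ v ∈ P ∩ latticePoints d, k v = k v₀ := fun v hv =>
    le_antisymm (hlt v₀ hv₀ v hv) (hlt v hv v₀ hv₀)
  have hcrossP : ∀ v ∈ P ∩ latticePoints d, ∀ v' ∈ P ∩ latticePoints d,
      u v + (v' - u v') ∈ P ∩ latticePoints d := by
    refine fun v hv v' hv' => ⟨H.mem_iff.2 fun F => ?_,
      latticePoints_add (hul v hv) (latticePoints_sub hv'.2 (hul v' hv'))⟩
    have := hcross v hv v' hv' F
    rw [hkeq v hv, hkeq v' hv'] at this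
    push_cast at this
    linarith
  let A : Set (Fin d) := {j | ∃ v ∈ P ∩ latticePoints d, ∃ v' ∈ P ∩ latticePoints d,
    u v j ≠ u v' j}
  have hcompl : ∀ j, j ∉ A → ∀ v ∈ P ∩ latticePoints d, ∀ v' ∈ P ∩ latticePoints d,
      u v j = u v' j := by
    intro j hj v hv v' hv'
    by_contra hne
    exact hj ⟨v, hv, v', hv', hne⟩
  have hA : ∀ j ∈ A, ∀ v ∈ P ∩ latticePoints d, ∀ v' ∈ P ∩ latticePoints d,
      u v j - v j = u v' j - v' j := by
    rintro j ⟨v₁, hv₁, v₂, hv₂, hne⟩ v hv v' hv'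
    have h01 : ∀ x ∈ P ∩ latticePoints d, ∀ y ∈ P ∩ latticePoints d,
        u x j + (y j - u y j) = 0 ∨ u x j + (y j - u y j) = 1 := fun x hx y hy =>
      hP.eq_zero_or_one (hcrossP x hx y hy).1 (hcrossP x hx y hy).2 j
    rcases h01 v₁ hv₁ v hv with h1 | h1 <;> rcases h01 v₂ hv₂ v hv with h2 | h2 <;>
    rcases h01 v₁ hv₁ v' hv' with h3 | h3 <;> rcases h01 v₂ hv₂ v' hv' with h4 | h4 <;>
    first
      | linarith
      | exact absurd (by linarith) hne
  have hmix : ∀ x ∈ P, ∀ y ∈ P, A.piecewise x y ∈ P := by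
    intro x hx y hy
    refine piecewise_mem_of_eq_convexHull hVP A (fun v hv v' hv' => ?_) hx hy
    have heq : A.piecewise v v' = u v + (v' - u v') := by
      ext j
      by_cases hj : j ∈ A
      · have := hA j hj v (hVL v hv) v' (hVL v' hv')
        simp only [Set.piecewise, hj, if_true, Pi.add_apply, Pi.sub_apply]
        linarith
      · have := hcompl j hj v (hVL v hv) v' (hVL v' hv')
        simp only [Set.piecewise, hj, if_false, Pi.add_apply, Pi.sub_apply]
        linarith
    rw [heq]
    exact (hcrossP v (hVL v hv) v' (hVL v' hv')).1
  have htight : ∀ F, ∃ v ∈ P ∩ latticePoints d, pairing (n F) v = -(h F : ℝ) := by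
    intro F
    by_contra! hcon
    obtain ⟨z, hzF, hzG⟩ := hF.exists_mem_relint H F
    have hzP : z ∈ P := H.mem_iff.2 fun G => by
      by_cases hG : G = F
      · rw [hG, hzF]
      · exact (hzG G hG).le
    rw [hVP] at hzP
    have : z ∈ {x | pairing (n F) x > -(h F : ℝ)} := by
      refine convexHull_min (fun v hv => ?_) (convex_pairing_gt _ _) hzP
      exact lt_of_le_of_ne (H.mem_iff.1 (hVL v hv).1 F) (hcon v (hVL v hv)).symm
    exact (ne_of_gt this) hzF
  have hK1 := hkpos v₀ hv₀
  have hK : (((k v₀).toNat : ℕ) : ℝ) = k v₀ := by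
    exact_mod_cast Int.toNat_of_nonneg (by linarith)
  have hK' : (((k v₀).toNat - 1 : ℕ) : ℝ) = k v₀ - 1 := by
    rw [Nat.cast_sub (by omega), hK, Nat.cast_one]
  refine ⟨fun j => if j ∈ A then (k v₀).toNat - 1 else (k v₀).toNat,
    A.piecewise (u v₀ - v₀) (u v₀), fun j => ?_, fun i j => ?_, fun F => ?_⟩
  · by_cases hj : j ∈ A
    · simpa [Set.piecewise, hj] using latticePoints_sub (hul v₀ hv₀) hv₀.2 j
    · simpa [Set.piecewise, hj] using hul v₀ hv₀ j
  · dsimp only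
    split_ifs <;> omega
  · obtain ⟨v, hv, hvF⟩ := htight F
    have hval : pairing (n F) (u v) + k v₀ * h F = 1 := by
      have h1 := hu v hv F
      have h2 := hant v hv F
      rw [pairing_sub] at h2
      rw [hkeq v hv] at h1 h2
      linarith
    obtain ⟨j₀, hj₀⟩ := Function.ne_iff.1 (H.ne_zero F)
    refine ⟨j₀, ?_⟩
    rcases hF.support_of_mix H A hmix F with hs | hs
    · refine ⟨fun j hj => by simp [hs j hj, hs j₀ hj₀], ?_⟩
      rw [pairing_congr (y := u v - v) fun j hj => ?_]
      · simp only [hs j₀ hj₀, if_true, hK', pairing_sub, hvF]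
        linarith
      · simpa [Set.piecewise, hs j hj] using hA j (hs j hj) v₀ hv₀ v hv
    · refine ⟨fun j hj => by simp [hs j hj, hs j₀ hj₀], ?_⟩
      rw [pairing_congr (y := u v) fun j hj => ?_]
      · simp only [hs j₀ hj₀, if_false, hK]
        exact hval
      · simpa [Set.piecewise, hs j hj] using hcompl j (hs j hj) v₀ hv₀ v hv

/-- A finite system of primitive integral half-spaces contains an irredundant subsystem. -/
lemma exists_isFacetPresentation {d : ℕ} {ι : Type*} [Finite ι] {P : Set (Fin d → ℝ)}
    {n : ι → Fin d → ℤ} {h : ι → ℤ} (hP : P = {x | ∀ i, pairing (n i) x ≥ -(h i : ℝ)})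
    (hn : ∀ i, Finset.univ.gcd (n i) = 1) :
    ∃ (m : ℕ) (f : Fin m → ι), IsFacetPresentation P (n ∘ f) (h ∘ f) := by
  classical
  have := Fintype.ofFinite ι
  obtain ⟨T, hT, hmin⟩ := exists_minimal_of_wellFoundedLT
    (fun T : Finset ι => P = {x | ∀ i ∈ T, pairing (n i) x ≥ -(h i : ℝ)})
    ⟨Finset.univ, by simpa using hP⟩
  refine ⟨T.card, fun l => (T.equivFin.symm l).1, ?_, fun l => hn _, fun l => ?_⟩
  · rw [hT]
    ext x
    constructor
    · intro hx l
      exact hx _ (T.equivFin.symm l).2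
    · intro hx i hi
      have := hx (T.equivFin ⟨i, hi⟩)
      simpa using this
  · by_contra! hcon
    set i : ι := (T.equivFin.symm l).1
    have hiT : i ∈ T := (T.equivFin.symm l).2
    have herase : P = {x | ∀ j ∈ T.erase i, pairing (n j) x ≥ -(h j : ℝ)} := by
      apply Subset.antisymm
      · intro x hx j hj
        rw [hT] at hx
        exact hx j (Finset.mem_of_mem_erase hj)
      · intro x hx
        rw [hT]
        intro j hj
        by_cases hji : j = i
        · by_contra hlt
          rw [hji] at hlt
          obtain ⟨l', hl', hlt'⟩ := hcon x (not_le.1 hlt)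
          refine absurd (hx (T.equivFin.symm l').1 (Finset.mem_erase.2 ⟨fun h0 => hl' ?_,
            (T.equivFin.symm l').2⟩)) (not_le.2 hlt')
          exact T.equivFin.symm.injective (Subtype.ext h0)
        · exact hx j (Finset.mem_erase.2 ⟨hji, hj⟩)
    exact Finset.notMem_erase i T (hmin herase (Finset.erase_subset i T) hiT)

/-- A product of Gorenstein `(0,1)`-polytopes has a facet presentation which splits. -/
lemma exists_isSplitting_of_product {d s : ℕ} {P : Set (Fin d → ℝ)} {dims : Fin s → ℕ}
    (e : Fin d ≃ (Σ i : Fin s, Fin (dims i))) {Q : ∀ i : Fin s, Set (Fin (dims i) → ℝ)}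
    {a : Fin s → ℕ} (hdims : ∀ i, 1 ≤ dims i)
    (hQ : ∀ i, Is01Polytope (Q i) ∧ (interior (Q i)).Nonempty ∧
      IsGorenstein (Q i) ∧ IsCodegree (Q i) (a i))
    (hPQ : (fun (x : Fin d → ℝ) => x ∘ e.symm) '' P =
      {y : (Σ i : Fin s, Fin (dims i)) → ℝ | ∀ i, (fun j => y ⟨i, j⟩) ∈ Q i}) :
    ∃ (m : ℕ) (n : Fin m → Fin d → ℤ) (h : Fin m → ℤ) (w : Fin d → ℝ),
      IsFacetPresentation P n h ∧ w ∈ latticePoints d ∧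
      IsSplitting n h (fun j => a (e j).1) w := by
  classical
  have hfac : ∀ i, ∃ (w : Fin (dims i) → ℝ) (S : Finset (Fin (dims i) → ℤ))
      (h : (Fin (dims i) → ℤ) → ℤ), w ∈ latticePoints (dims i) ∧
      Q i = {x | ∀ n ∈ S, pairing n x ≥ -(h n : ℝ)} ∧
      ∀ n ∈ S, Finset.univ.gcd n = 1 ∧ pairing n w + a i * h n = 1 := by
    intro i
    obtain ⟨h01, hint, ⟨k, w, hk, hw, hR⟩, ha⟩ := hQ i
    obtain ⟨S, h, hS, hn⟩ := exists_halfSpaces_of_isReflexive h01.isLatticePolytope hk hw hR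
    have H : IsHalfSpacePresentation (Q i) (fun n : S => (n : Fin (dims i) → ℤ))
        (fun n : S => h n) := by
      refine ⟨?_, fun n h0 => ?_, h01.isLatticePolytope.isBounded, hint⟩
      · rw [hS]
        ext x
        exact ⟨fun hx n => hx n n.2, fun hx n hnS => hx ⟨n, hnS⟩⟩
      · have h1 := (hn n n.2).1
        rw [h0, (Finset.gcd_eq_zero_iff (f := (0 : Fin (dims i) → ℤ))).2 fun _ _ => rfl] at h1
        exact zero_ne_one h1
    obtain rfl := ha.unique (H.isCodegree (hdims i) hk hw fun n => (hn n n.2).2)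
    exact ⟨w, S, h, hw, hS, hn⟩
  choose w S h hw hS hn using hfac
  let τ : ∀ i, Fin (dims i) → Fin d := fun i l => e.symm ⟨i, l⟩
  have hτ : ∀ i, Function.Injective (τ i) := fun i l l' hl => by simpa [τ] using hl
  let N : (Σ i, S i) → Fin d → ℤ := fun ν => Function.extend (τ ν.1) ν.2 0
  let b : (Σ i, S i) → ℤ := fun ν => h ν.1 ν.2
  have hNτ : ∀ ν, N ν ∘ τ ν.1 = ν.2 := fun ν => funext fun l => (hτ ν.1).extend_apply _ _ _
  have hsupp : ∀ ν j, N ν j ≠ 0 → j ∈ range (τ ν.1) := by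
    intro ν j hj
    by_contra hne
    exact hj (Function.extend_apply' _ _ _ hne)
  have hpair : ∀ ν x, pairing (N ν) x = pairing (ν.2 : Fin (dims ν.1) → ℤ) (x ∘ τ ν.1) := by
    intro ν x
    rw [← hNτ ν, pairing_comp (hτ ν.1) (hsupp ν)]
  have hmem : ∀ x, x ∈ P ↔ ∀ i, x ∘ τ i ∈ Q i := by
    intro x
    have hinj : Function.Injective fun (x : Fin d → ℝ) => x ∘ e.symm :=
      e.symm.surjective.injective_comp_right
    rw [← hinj.mem_set_image, hPQ]
    rfl
  have hPN : P = {x | ∀ ν, pairing (N ν) x ≥ -(b ν : ℝ)} := by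
    ext x
    rw [hmem]
    constructor
    · intro hx ν
      have h1 := hx ν.1
      rw [hS] at h1
      rw [hpair]
      exact h1 ν.2 ν.2.2
    · intro hx i
      rw [hS]
      intro ν hν
      have := hx ⟨i, ν, hν⟩
      rwa [hpair] at this
  have hgcd : ∀ ν, Finset.univ.gcd (N ν) = 1 := by
    intro ν
    have h1 : Finset.univ.gcd (N ν) ∣ 1 := by
      rw [← (hn ν.1 ν.2 ν.2.2).1]
      refine Finset.dvd_gcd fun l _ => ?_
      rw [← hNτ ν]
      exact Finset.gcd_dvd (Finset.mem_univ (τ ν.1 l))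
    rw [← Finset.normalize_gcd]
    exact normalize_eq_one.2 (isUnit_of_dvd_one h1)
  obtain ⟨m, f, hf⟩ := exists_isFacetPresentation hPN hgcd
  refine ⟨m, N ∘ f, b ∘ f, fun j => w (e j).1 (e j).2, hf, fun j => hw _ _, fun F => ?_⟩
  have hweight : ∀ i l, a (e (τ i l)).1 = a i := fun i l => by simp [τ]
  refine ⟨τ (f F).1 ⟨0, hdims _⟩, fun j hj => ?_, ?_⟩
  · obtain ⟨l, rfl⟩ := hsupp (f F) j hj
    simp only [hweight]
  · have hwτ : (fun j => w (e j).1 (e j).2) ∘ τ (f F).1 = w (f F).1 := by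
      ext l
      simp only [τ, Function.comp_apply]
      rw [e.apply_symm_apply]
    change pairing (N (f F)) _ + (a (e (τ (f F).1 ⟨0, hdims _⟩)).1 : ℝ) * b (f F) = 1
    rw [hweight, hpair, hwτ]
    exact (hn _ _ (f F).2.2).2

theorem stmt_18 {d : ℕ} (hd : 1 ≤ d) (P : Set (Fin d → ℝ))
    (hP : Is01Polytope P) (hfull : (interior P).Nonempty) (hidp : IsIDP P) :
    NearlyGorenstein P ↔
    ∃ (s : ℕ) (dims : Fin s → ℕ) (e : Fin d ≃ (Σ i : Fin s, Fin (dims i)))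
      (Q : ∀ i : Fin s, Set (Fin (dims i) → ℝ)) (a : Fin s → ℕ),
      1 ≤ s ∧ (∀ i, 1 ≤ dims i) ∧ (∑ i, dims i = d) ∧
      (∀ i, Is01Polytope (Q i) ∧ (interior (Q i)).Nonempty ∧
        IsGorenstein (Q i) ∧ IsCodegree (Q i) (a i)) ∧
      (∀ i j : Fin s, i < j → |(a i : ℤ) - (a j : ℤ)| ≤ 1) ∧
      (fun (x : Fin d → ℝ) => x ∘ e.symm) '' P =
        {y : (Σ i : Fin s, Fin (dims i)) → ℝ | ∀ i, (fun j => y ⟨i, j⟩) ∈ Q i} := by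
  constructor
  · rintro ⟨m, n, h, hF, hNG⟩
    have H := hF.isHalfSpacePresentation hP hfull
    obtain ⟨c, w, hw, hc, hS⟩ := hF.exists_isSplitting H hP hd hNG
    exact hS.exists_product H hd hP hw hc
  · rintro ⟨s, dims, e, Q, a, -, hdims, -, hQ, ha, hPQ⟩
    obtain ⟨m, n, h, w, hF, hw, hS⟩ := exists_isSplitting_of_product e hdims hQ hPQ
    refine ⟨m, n, h, hF, hS.ngIncl (hF.isHalfSpacePresentation hP hfull) hd hidp hw ?_⟩
    intro i j
    rcases lt_trichotomy (e i).1 (e j).1 with hij | hij | hij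
    · have := abs_le.1 (ha _ _ hij)
      omega
    · rw [hij]
      exact Nat.le_succ _
    · have := abs_le.1 (ha _ _ hij)
      omega
end
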